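/- arXiv:1901.10063 — 4 statements merged into one kernel-verified Lean document; each statement's English description precedes it below -/
import Mathlib

section
/- Let G be a finite abelian group of order v = p₁^{2k₁} · p₂^{2k₂} ⋯ pₙ^{2kₙ}, where n ≥ 2 and p₁, p₂, …, pₙ are pairwise distinct odd prime numbers and k₁, …, kₙ are positive integers. If there exists a regular Paley type partial difference set D in G, then for every i with 1 ≤ i ≤ n such that kᵢ is odd, one has pᵢ ≡ 3 (mod 4). -/
open Finset

variable {G : Type*} [CommGroup G] [Fintype G] [DecidableEq G]

/-- `D` is a `(v,k,l,m)`-partial difference set in `G`: every non-identity element of `D`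
has exactly `l` representations as `d₁ * d₂⁻¹` with `d₁ ≠ d₂` in `D`, and every
non-identity element not in `D` has exactly `m` such representations. -/
def IsPDS (D : Finset G) (v k l m : ℕ) : Prop :=
  Fintype.card G = v ∧ D.card = k ∧
  (∀ g : G, g ≠ 1 → g ∈ D →
    ((D ×ˢ D).filter (fun x => x.1 ≠ x.2 ∧ x.1 * x.2⁻¹ = g)).card = l) ∧
  (∀ g : G, g ≠ 1 → g ∉ D →
    ((D ×ˢ D).filter (fun x => x.1 ≠ x.2 ∧ x.1 * x.2⁻¹ = g)).card = m)

/-- A regular PDS: additionally `D⁽⁻¹⁾ = D` and `1 ∉ D`. -/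
def IsRegularPDS (D : Finset G) (v k l m : ℕ) : Prop :=
  IsPDS D v k l m ∧ (∀ d : G, d ∈ D ↔ d⁻¹ ∈ D) ∧ (1 : G) ∉ D

/-- A regular Paley type PDS: a regular `(v, (v-1)/2, (v-5)/4, (v-1)/4)`-PDS,
encoded without division as `v = 2k+1`, `v = 4l+5`, `v = 4m+1`. -/
def IsPaleyPDS (D : Finset G) : Prop :=
  ∃ k l m : ℕ, IsRegularPDS D (Fintype.card G) k l m ∧
    Fintype.card G = 2 * k + 1 ∧ Fintype.card G = 4 * l + 5 ∧ Fintype.card G = 4 * m + 1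


theorem frob_aux {H : Type*} [CommGroup H] (p : ℕ) [hp : Fact p.Prime]
    (x : MonoidAlgebra (ZMod p) H) :
    x ^ p = MonoidAlgebra.mapDomain (fun g => g ^ p) x := by
  have : CharP (MonoidAlgebra (ZMod p) H) p :=
    charP_of_injective_algebraMap (algebraMap (ZMod p) (MonoidAlgebra (ZMod p) H)).injective p
  induction x using MonoidAlgebra.induction_linear with
  | zero => simp [hp.out.ne_zero]
  | add a b ha hb => rw [add_pow_char, ha, hb, MonoidAlgebra.mapDomain_add]
  | single a b => rw [MonoidAlgebra.single_pow, MonoidAlgebra.mapDomain_single, ZMod.pow_card]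

theorem pow_inj_aux {H : Type*} [CommGroup H] [Finite H] (t : ℕ) (ht : (Nat.card H).Coprime t) :
    Function.Injective (fun g : H => g ^ t) :=
  (powCoprime ht).injective

theorem map_eq_zero_aux {H : Type*} [CommGroup H] (p : ℕ) [Fact p.Prime]
    (y : MonoidAlgebra ℤ H) :
    MonoidAlgebra.mapRingHom H (Int.castRingHom (ZMod p)) y = 0 ↔ ∀ h, (p : ℤ) ∣ y.coeff h := by
  constructor
  · intro h g
    have := congrArg (fun z => z.coeff g) h
    simpa [ZMod.intCast_zmod_eq_zero_iff_dvd] using this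
  · intro h
    ext g
    simpa [ZMod.intCast_zmod_eq_zero_iff_dvd] using h g

theorem sq_dvd_aux {H : Type*} [CommGroup H] [Finite H] (p : ℕ) [hp : Fact p.Prime]
    (hc : (Nat.card H).Coprime p) (y : MonoidAlgebra ℤ H) (h : ∀ g, (p : ℤ) ∣ (y * y).coeff g) :
    ∀ g, (p : ℤ) ∣ y.coeff g := by
  rw [← map_eq_zero_aux] at h ⊢
  rw [map_mul] at h
  set z := MonoidAlgebra.mapRingHom H (Int.castRingHom (ZMod p)) y
  have h2 : z ^ p = 0 := by
    obtain ⟨q, hq⟩ := Nat.exists_eq_add_of_le hp.out.two_le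
    have : z ^ p = z ^ (2 + q) := congrArg (fun n => z ^ n) hq
    rw [this, pow_add, sq, h, zero_mul]
  rw [frob_aux] at h2
  exact MonoidAlgebra.mapDomain_injective (pow_inj_aux p hc) (by simpa using h2)

theorem sq_dvd_pow_aux {H : Type*} [CommGroup H] [Finite H] (p : ℕ) [hp : Fact p.Prime]
    (hc : (Nat.card H).Coprime p) (k : ℕ) : ∀ (y z : MonoidAlgebra ℤ H),
    y * y = ((p : ℤ) ^ (2 * k)) • z →
    ∃ u : MonoidAlgebra ℤ H, y = ((p : ℤ) ^ k) • u ∧ u * u = z := by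
  induction k with
  | zero => intro y z h; exact ⟨y, by simp, by simpa using h⟩
  | succ k ih =>
    intro y z h
    have h1 := sq_dvd_aux p hc y (by
      intro g; rw [h, MonoidAlgebra.coeff_smul_apply, smul_eq_mul]
      exact Dvd.dvd.mul_right (dvd_pow_self _ (by omega)) _)
    obtain ⟨u, hu⟩ : ∃ u : MonoidAlgebra ℤ H, y = (p : ℤ) • u := by
      refine ⟨.ofCoeff (y.coeff.mapRange (fun n => n / p) (by simp)), ?_⟩
      ext g
      rw [MonoidAlgebra.coeff_smul_apply]
      simp [Int.mul_ediv_cancel' (h1 g)]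
    have hp0 : (p : ℤ) ≠ 0 := by exact_mod_cast hp.out.ne_zero
    have h3 : u * u = ((p : ℤ) ^ (2 * k)) • z := by
      rw [hu] at h
      ext g
      have := congrArg (fun z => z.coeff g) h
      simp only [smul_mul_smul_comm, MonoidAlgebra.coeff_smul_apply, smul_eq_mul] at this ⊢
      have hpp : (p : ℤ) * p ≠ 0 := mul_ne_zero hp0 hp0
      apply mul_left_cancel₀ hpp
      rw [this]; ring
    obtain ⟨u', hu', hz⟩ := ih u z h3
    exact ⟨u', by rw [hu, hu', smul_smul, pow_succ']; , hz⟩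

theorem fiber_aux {H : Type*} [CommGroup H] [Finite H] [DecidableEq H] (p m : ℕ) (hp : p.Prime)
    (hm : Nat.card H = p ^ m) (Y : Finset H) (h1 : (1 : H) ∉ Y)
    (hY : ∀ a ∈ Y, ∀ t : ℕ, t.Coprime p → a ^ t ∈ Y) : (p - 1) ∣ Y.card := by
  classical
  rw [Finset.card_eq_sum_card_image (fun a => Subgroup.zpowers a) Y]
  apply Finset.dvd_sum
  intro Z hZ
  obtain ⟨a, ha, rfl⟩ := Finset.mem_image.1 hZ
  obtain ⟨e, -, he⟩ := (Nat.dvd_prime_pow hp).1 (hm ▸ orderOf_dvd_natCard a)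
  have he0 : e ≠ 0 := by
    rintro rfl
    rw [pow_zero, orderOf_eq_one_iff] at he
    exact h1 (he ▸ ha)
  have : (Y.filter (fun b => Subgroup.zpowers b = Subgroup.zpowers a)).card
      = Nat.totient (orderOf a) := by
    rw [Nat.totient]
    symm
    apply Finset.card_bij (fun t _ => a ^ t)
    · intro t ht
      simp only [Finset.mem_filter, Finset.mem_range] at ht ⊢
      refine ⟨hY a ha t ?_, ?_⟩
      · rw [he] at ht
        exact ((Nat.coprime_pow_left_iff (Nat.pos_of_ne_zero he0) _ _).1 ht.2).symm
      · apply Subgroup.eq_of_le_of_card_ge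
        · rw [Subgroup.zpowers_le]; exact Subgroup.npow_mem_zpowers a t
        · rw [Nat.card_zpowers, Nat.card_zpowers, ht.2.orderOf_pow]
    · intro s hs t ht hst
      simp only [Finset.mem_filter, Finset.mem_range] at hs ht
      exact pow_injOn_Iio_orderOf hs.1 ht.1 hst
    · intro b hb
      simp only [Finset.mem_filter] at hb
      have hb2 : b ∈ Subgroup.zpowers a := hb.2 ▸ Subgroup.mem_zpowers b
      have hf : IsOfFinOrder a := isOfFinOrder_of_finite a
      rw [← hf.mem_powers_iff_mem_zpowers, hf.mem_powers_iff_mem_range_orderOf] at hb2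
      simp only [Finset.mem_image, Finset.mem_range] at hb2
      obtain ⟨t, ht, rfl⟩ := hb2
      refine ⟨t, ?_, rfl⟩
      simp only [Finset.mem_filter, Finset.mem_range]
      refine ⟨ht, ?_⟩
      have h3 : orderOf (a ^ t) = orderOf a := by
        rw [← Nat.card_zpowers, ← Nat.card_zpowers, hb.2]
      rw [orderOf_pow] at h3
      have hpos : 0 < orderOf a := hf.orderOf_pos
      rw [Nat.div_eq_self] at h3
      rcases h3 with h3 | h3
      · omega
      · exact h3
  rw [this, he, Nat.totient_prime_pow hp (Nat.pos_of_ne_zero he0)]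
  exact Dvd.intro_left _ rfl

theorem J_coeff_aux {H : Type*} [CommGroup H] [Fintype H] (g : H) :
    (∑ h : H, MonoidAlgebra.single h (1 : ℤ)).coeff g = 1 := by
  classical
  simp [MonoidAlgebra.coeff_sum, Finsupp.single_apply]

theorem mul_J_aux {H : Type*} [CommGroup H] [Fintype H] (y : MonoidAlgebra ℤ H) :
    y * (∑ h : H, MonoidAlgebra.single h (1 : ℤ)) =
      (∑ h, y.coeff h) • (∑ h : H, MonoidAlgebra.single h (1 : ℤ)) := by
  classical
  induction y using MonoidAlgebra.induction_linear with
  | zero => simp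
  | add a b ha hb => rw [add_mul, ha, hb, ← add_smul]; simp [Finset.sum_add_distrib]
  | single a b =>
    rw [Finset.mul_sum, Finset.smul_sum]
    simp only [MonoidAlgebra.single_mul_single, MonoidAlgebra.smul_single]
    apply Fintype.sum_equiv (Equiv.mulLeft a)
    intro x
    simp [Finsupp.single_apply]

theorem DD_aux {H : Type*} [CommGroup H] [Fintype H] [DecidableEq H] (D : Finset H)
    (hinv : ∀ d : H, d ∈ D ↔ d⁻¹ ∈ D) (g : H) :
    ((∑ h ∈ D, MonoidAlgebra.single h (1 : ℤ)) * (∑ h ∈ D, MonoidAlgebra.single h (1 : ℤ))).coeff g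
      = ((D ×ˢ D).filter (fun x => x.1 * x.2⁻¹ = g)).card := by
  rw [Finset.sum_mul_sum, ← Finset.sum_product']
  simp only [MonoidAlgebra.single_mul_single, MonoidAlgebra.coeff_sum, MonoidAlgebra.coeff_single,
    Finsupp.finsetSum_apply, Finsupp.single_apply, mul_one]
  rw [Finset.sum_boole]
  norm_cast
  apply Finset.card_bij (fun x _ => (x.1, x.2⁻¹))
  · intro x hx
    simp only [Finset.mem_filter, Finset.mem_product] at hx ⊢
    exact ⟨⟨hx.1.1, (hinv _).1 hx.1.2⟩, by simpa using hx.2⟩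
  · rintro ⟨a, b⟩ - ⟨c, d⟩ - h
    simpa using h
  · rintro ⟨a, b⟩ h
    simp only [Finset.mem_filter, Finset.mem_product] at h
    exact ⟨(a, b⁻¹), by simpa [← hinv] using h, by simp⟩

theorem paley_aux {H : Type*} [CommGroup H] [Fintype H] [DecidableEq H] (D : Finset H)
    (hD : IsPaleyPDS D) :
    ∃ x : MonoidAlgebra ℤ H, x.coeff 1 = 0 ∧ (∀ g, g ≠ 1 → x.coeff g = 1 ∨ x.coeff g = -1) ∧
      (∀ g, x.coeff g⁻¹ = x.coeff g) ∧
      x * x = (Fintype.card H : ℤ) • 1 - (∑ h : H, MonoidAlgebra.single h (1 : ℤ)) ∧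
      x * (∑ h : H, MonoidAlgebra.single h (1 : ℤ)) = 0 := by
  obtain ⟨k, l, m, ⟨⟨-, hk, hl, hm⟩, hinv, h1⟩, hc1, hc2, hc3⟩ := hD
  set J : MonoidAlgebra ℤ H := ∑ h : H, MonoidAlgebra.single h (1 : ℤ) with hJ
  set d : MonoidAlgebra ℤ H := ∑ h ∈ D, MonoidAlgebra.single h (1 : ℤ) with hd
  have hdc : ∀ g, d.coeff g = if g ∈ D then 1 else 0 := by
    intro g
    simp [hd, MonoidAlgebra.coeff_sum, Finsupp.single_apply]
  have hJc : ∀ g, J.coeff g = 1 := J_coeff_aux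
  have h1c : ∀ g : H, (1 : MonoidAlgebra ℤ H).coeff g = if g = 1 then 1 else 0 := by
    intro g
    simp [MonoidAlgebra.one_def, Finsupp.single_apply, eq_comm]
  have hdd : d * d = (m : ℤ) • 1 - d + (m : ℤ) • J := by
    ext g
    rw [hd, DD_aux D hinv g, ← hd]
    simp only [MonoidAlgebra.coeff_add, MonoidAlgebra.coeff_sub, MonoidAlgebra.coeff_smul,
      Finsupp.add_apply, Finsupp.sub_apply, Finsupp.smul_apply, smul_eq_mul, hdc, hJc, h1c]
    by_cases hg : g = 1
    · subst hg
      have : ((D ×ˢ D).filter (fun x => x.1 * x.2⁻¹ = 1)).card = D.card := by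
        symm
        apply Finset.card_bij (fun a _ => (a, a))
        · intro a ha; simpa using ha
        · intro a _ b _ h; simpa using h
        · rintro ⟨a, b⟩ h
          simp only [Finset.mem_filter, Finset.mem_product, mul_inv_eq_one] at h
          exact ⟨a, h.1.1, by simp [h.2]⟩
      rw [this, hk, if_pos rfl, if_neg h1]
      push_cast; omega
    · have : ((D ×ˢ D).filter (fun x => x.1 * x.2⁻¹ = g)) =
          ((D ×ˢ D).filter (fun x => x.1 ≠ x.2 ∧ x.1 * x.2⁻¹ = g)) := by
        apply Finset.filter_congr
        rintro ⟨a, b⟩ -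
        constructor
        · intro h
          refine ⟨?_, h⟩
          rintro h2
          apply hg
          rw [← h, h2]; simp
        · exact fun h => h.2
      rw [this, if_neg hg]
      by_cases hgD : g ∈ D
      · rw [hl g hg hgD, if_pos hgD]; omega
      · rw [hm g hg hgD, if_neg hgD]; omega
  have hdJ : d * J = (2 * m : ℤ) • J := by
    rw [hJ, mul_J_aux, ← hJ]
    congr 1
    simp only [hdc]
    simp [hk]; omega
  have hJJ : J * J = (4 * m + 1 : ℤ) • J := by
    nth_rw 2 [hJ]
    rw [mul_J_aux, ← hJ]
    congr 1
    simp [hJc, hc3]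
  refine ⟨2 • d - J + 1, ?_, ?_, ?_, ?_, ?_⟩
  · simp only [MonoidAlgebra.coeff_add, MonoidAlgebra.coeff_sub, MonoidAlgebra.coeff_smul,
      Finsupp.add_apply, Finsupp.sub_apply, Finsupp.smul_apply, hdc, hJc, h1c, if_neg h1]
    simp
  · intro g hg
    simp only [MonoidAlgebra.coeff_add, MonoidAlgebra.coeff_sub, MonoidAlgebra.coeff_smul,
      Finsupp.add_apply, Finsupp.sub_apply, Finsupp.smul_apply, hdc, hJc, h1c, if_neg hg]
    split_ifs <;> simp
  · intro g
    simp only [MonoidAlgebra.coeff_add, MonoidAlgebra.coeff_sub, MonoidAlgebra.coeff_smul,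
      Finsupp.add_apply, Finsupp.sub_apply, Finsupp.smul_apply, hdc, hJc, h1c, ← hinv,
      inv_eq_one]
  · have : (2 • d - J + 1) * (2 • d - J + 1) = (4 : ℤ) • (d * d) + J * J + 1 - (4 : ℤ) • (d * J)
        + (4 : ℤ) • d - (2 : ℤ) • J := by
      simp only [zsmul_eq_mul, nsmul_eq_mul]; push_cast; ring
    rw [this, hdd, hdJ, hJJ, hc3]
    simp only [zsmul_eq_mul]; push_cast; ring
  · have : (2 • d - J + 1) * J = (2 : ℤ) • (d * J) - J * J + J := by
      simp only [zsmul_eq_mul, nsmul_eq_mul]; push_cast; ring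
    rw [this, hdJ, hJJ]
    simp only [zsmul_eq_mul]; push_cast; ring

theorem mult_prime_aux {H : Type*} [CommGroup H] [Fintype H] (x : MonoidAlgebra ℤ H)
    (J : MonoidAlgebra ℤ H) (w : ℕ)
    (hx : ∀ g, x.coeff g = 0 ∨ x.coeff g = 1 ∨ x.coeff g = -1)
    (hxx : x * x = ((w : ℤ) ^ 2) • 1 - J) (hxJ : x * J = 0) (hw : Fintype.card H = w ^ 2)
    (t : ℕ) (ht : t.Prime) (ht2 : t ≠ 2) (htw : ¬ t ∣ w) (g : H) :
    x.coeff (g ^ t) = x.coeff g := by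
  have := Fact.mk ht
  obtain ⟨s, hs⟩ := ht.odd_of_ne_two ht2
  have hpow : ∀ s : ℕ, x ^ (2 * s + 1) = ((w : ℤ) ^ (2 * s)) • x := by
    intro s
    induction s with
    | zero => simp
    | succ s ih =>
      have : x ^ (2 * (s + 1) + 1) = x ^ (2 * s + 1) * (x * x) := by ring
      rw [this, ih, hxx, mul_sub, smul_mul_assoc, smul_mul_assoc, hxJ, mul_smul_comm, smul_smul]
      simp only [mul_one, smul_zero, sub_zero]
      congr 1; ring
  have hcop : (Nat.card H).Coprime t := by
    rw [Nat.card_eq_fintype_card, hw]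
    exact (Nat.Coprime.pow_right 2 ((ht.coprime_iff_not_dvd).2 htw)).symm
  let φ := MonoidAlgebra.mapRingHom H (Int.castRingHom (ZMod t))
  have h1 : (φ x) ^ t = MonoidAlgebra.mapDomain (fun g => g ^ t) (φ x) := frob_aux t _
  have h2 : (φ x) ^ t = φ x := by
    rw [← map_pow]
    have : x ^ t = ((w : ℤ) ^ (2 * s)) • x := by rw [← hpow]; exact congrArg (fun n => x ^ n) hs
    rw [this, map_zsmul]
    have hw1 : ((w : ZMod t)) ^ (2 * s) = 1 := by
      have h2s : 2 * s = t - 1 := by omega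
      rw [h2s]
      apply ZMod.pow_card_sub_one_eq_one
      rwa [Ne, ZMod.natCast_eq_zero_iff]
    ext a
    rw [MonoidAlgebra.coeff_smul_apply, zsmul_eq_mul]
    push_cast
    rw [hw1, one_mul]
  have h3 : (φ x).coeff (g ^ t) = (φ x).coeff g := by
    conv_lhs => rw [← h2, h1]
    exact Finsupp.mapDomain_apply (pow_inj_aux t hcop) _ g
  have h4 : ((x.coeff (g ^ t) : ℤ) : ZMod t) = (x.coeff g : ℤ) := by
    simpa [φ] using h3
  rw [ZMod.intCast_eq_intCast_iff_dvd_sub] at h4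
  have h5 := Int.le_of_dvd (a := (t : ℤ)) (b := |x.coeff g - x.coeff (g ^ t)|)
  have ht3 : 3 ≤ t := by have := ht.two_le; omega
  by_contra hne
  have h6 := h5 (abs_pos.2 (sub_ne_zero.2 (Ne.symm hne))) ((dvd_abs _ _).2 h4)
  rcases hx g with h | h | h <;> rcases hx (g ^ t) with h' | h' | h' <;> rw [h, h'] at h6 <;>
    norm_num at h6 <;> omega

theorem mult_aux {H : Type*} [CommGroup H] [Fintype H] (x : MonoidAlgebra ℤ H)
    (J : MonoidAlgebra ℤ H) (w : ℕ)
    (hx : ∀ g, x.coeff g = 0 ∨ x.coeff g = 1 ∨ x.coeff g = -1)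
    (hxx : x * x = ((w : ℤ) ^ 2) • 1 - J) (hxJ : x * J = 0) (hw : Fintype.card H = w ^ 2)
    (t : ℕ) : t.Coprime (2 * w) → ∀ g : H, x.coeff (g ^ t) = x.coeff g := by
  induction t using Nat.recOnMul with
  | zero =>
    intro h g
    simp at h
  | one => simp
  | prime t ht =>
    intro h g
    rw [ht.coprime_iff_not_dvd] at h
    refine mult_prime_aux x J w hx hxx hxJ hw t ht ?_ ?_ g
    · rintro rfl; exact h (Dvd.intro _ rfl)
    · intro h'; exact h (Dvd.dvd.mul_left h' _)
  | mul a b ha hb =>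
    intro h g
    rw [pow_mul, hb (Nat.Coprime.coprime_mul_left h), ha (Nat.Coprime.coprime_mul_right h)]

theorem push_coeff_aux {H : Type*} [CommGroup H] [Fintype H] (N : Subgroup H) [Fintype N]
    (y : MonoidAlgebra ℤ H) (b : H) :
    (MonoidAlgebra.mapDomainRingHom ℤ (QuotientGroup.mk' N) y).coeff (QuotientGroup.mk' N b) =
      ∑ a : N, y.coeff ((a : H) * b) := by
  classical
  induction y using MonoidAlgebra.induction_linear with
  | zero => simp
  | add y z hy hz =>
    rw [map_add, MonoidAlgebra.coeff_add, Finsupp.add_apply, hy, hz, ← Finset.sum_add_distrib]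
    rfl
  | single c r =>
    have h0 : MonoidAlgebra.mapDomainRingHom ℤ (QuotientGroup.mk' N) (MonoidAlgebra.single c r)
        = MonoidAlgebra.single (QuotientGroup.mk' N c) r := MonoidAlgebra.mapDomain_single
    rw [h0]
    simp only [MonoidAlgebra.coeff_single, Finsupp.single_apply]
    by_cases h : c * b⁻¹ ∈ N
    · have h1 : QuotientGroup.mk' N c = QuotientGroup.mk' N b := by
        simp only [QuotientGroup.mk'_apply]
        rw [QuotientGroup.eq, ← N.inv_mem_iff]
        simpa [mul_comm] using h
      rw [if_pos h1, Finset.sum_eq_single (⟨c * b⁻¹, h⟩ : N)]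
      · simp
      · rintro a - ha
        rw [if_neg]
        rintro rfl
        apply ha
        ext; simp
      · simp
    · have h1 : QuotientGroup.mk' N c ≠ QuotientGroup.mk' N b := by
        simp only [QuotientGroup.mk'_apply]
        intro h2
        rw [QuotientGroup.eq, ← N.inv_mem_iff] at h2
        exact h (by simpa [mul_comm] using h2)
      rw [if_neg h1, Finset.sum_eq_zero]
      intro a _
      rw [if_neg]
      rintro rfl
      exact h (by simp)

theorem arith_aux (p k c : ℕ) (ε δ : ℤ) (hp : p % 4 = 1) (hp5 : 5 ≤ p) (hk : Odd k)
    (hε : ε = 1 ∨ ε = -1) (hδ : δ = 1 ∨ δ = -1)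
    (h : (p : ℤ) ^ (2 * k) - 2 * ((p - 1) * c) - (1 - δ) = ε * p ^ k) : False := by
  obtain ⟨r, hr, hrodd⟩ : ∃ r : ℤ, (p : ℤ) ^ k - 1 = (p - 1) * r ∧ Odd r := by
    refine ⟨∑ i ∈ Finset.range k, (p : ℤ) ^ i, (mul_geom_sum _ _).symm, ?_⟩
    have hn : Odd (∑ i ∈ Finset.range k, p ^ i) := by
      rw [Finset.odd_sum_iff_odd_card_odd]
      have : (Finset.range k).filter (fun i => Odd (p ^ i)) = Finset.range k := by
        apply Finset.filter_true_of_mem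
        intro i _
        apply Odd.pow
        rw [Nat.odd_iff]; omega
      rw [this]; simpa using hk
    exact_mod_cast hn
  obtain ⟨q, hq⟩ : ∃ q : ℤ, (p : ℤ) = 4 * q + 1 := ⟨(p : ℤ) / 4, by omega⟩
  have hq1 : 1 ≤ q := by omega
  obtain ⟨s, hs⟩ := hrodd
  have hP : (p : ℤ) ^ k = 1 + 4 * q * r := by rw [hq] at hr ⊢; linarith
  have hPP : (p : ℤ) ^ (2 * k) = (1 + 4 * q * r) * (1 + 4 * q * r) := by
    rw [two_mul, pow_add, hP]
  rw [hPP, hP] at h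
  have hp1 : (p : ℤ) - 1 = 4 * q := by omega
  rw [hp1] at h
  have key : ε * (1 + 4 * q * r) - δ = 8 * q * (r * (1 + 2 * q * r) - c) := by
    linear_combination -h
  set z := r * (1 + 2 * q * r) - c
  have hq0 : q ≠ 0 := by omega
  have same : q * (r - 2 * z) = 0 → False := by
    intro h
    rcases mul_eq_zero.1 h with h | h <;> omega
  have same' : q * (r + 2 * z) = 0 → False := by
    intro h
    rcases mul_eq_zero.1 h with h | h <;> omega
  rcases hε with rfl | rfl <;> rcases hδ with rfl | rfl
  · exact same (by linarith)
  · have : 2 * (q * (2 * z - r)) = 1 := by linarith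
    omega
  · have : 2 * (q * (2 * z + r)) = -1 := by linarith
    omega
  · exact same' (by linarith)

theorem core_aux {H : Type*} [CommGroup H] [Fintype H] [DecidableEq H] (D : Finset H)
    (hD : IsPaleyPDS D) (p k m : ℕ) (hp : p.Prime) (hp4 : p % 4 = 1) (hk : Odd k)
    (hcard : Fintype.card H = (p ^ k * m) ^ 2) (hpm : ¬ p ∣ m) (hm : m ≠ 1) : False := by
  classical
  have := Fact.mk hp
  obtain ⟨x, hx1, hxpm, hxinv, hxx, hxJ⟩ := paley_aux D hD
  have hp5 : 5 ≤ p := by have := hp.two_le; omega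
  have hm0 : m ≠ 0 := by rintro rfl; simp at hpm
  have hppos : 0 < p ^ (2 * k) := pow_pos hp.pos _
  have hcopm : Nat.Coprime p m := (hp.coprime_iff_not_dvd).2 hpm
  have hx : ∀ g, x.coeff g = 0 ∨ x.coeff g = 1 ∨ x.coeff g = -1 := by
    intro g
    by_cases hg : g = 1
    · left; rw [hg, hx1]
    · right; exact hxpm g hg
  have hmult : ∀ t : ℕ, t.Coprime (2 * (p ^ k * m)) → ∀ g : H, x.coeff (g ^ t) = x.coeff g := by
    intro t
    refine mult_aux x _ (p ^ k * m) hx ?_ hxJ hcard t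
    rw [hxx, hcard]; push_cast; rfl
  -- the Sylow subgroup
  let N : Subgroup H := (default : Sylow p H)
  have hNc : Nat.card N = p ^ (2 * k) := by
    have h1 := (default : Sylow p H).card_eq_multiplicity
    rw [Nat.card_eq_fintype_card (α := H), hcard] at h1
    have h2 : ((p ^ k * m) ^ 2).factorization p = 2 * k := by
      rw [Nat.factorization_pow, Nat.factorization_mul (pow_ne_zero _ hp.ne_zero) hm0,
        Nat.Prime.factorization_pow hp]
      simp [Nat.factorization_eq_zero_of_not_dvd hpm]
    rw [h2] at h1
    exact h1
  have hNf : Fintype.card N = p ^ (2 * k) := by rw [← Nat.card_eq_fintype_card, hNc]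
  have hQc : Nat.card (H ⧸ N) = m ^ 2 := by
    have h1 := N.card_eq_card_quotient_mul_card_subgroup
    rw [hNc, Nat.card_eq_fintype_card (α := H), hcard] at h1
    have h2 : (p ^ k * m) ^ 2 = m ^ 2 * p ^ (2 * k) := by ring
    rw [h2] at h1
    exact (Nat.eq_of_mul_eq_mul_right hppos h1).symm
  have hQf : Fintype.card (H ⧸ N) = m ^ 2 := by rw [← Nat.card_eq_fintype_card, hQc]
  let π := QuotientGroup.mk' N
  have hπs : Function.Surjective π := QuotientGroup.mk'_surjective N
  let F := MonoidAlgebra.mapDomainRingHom ℤ π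
  have hF : ∀ z b, (F z).coeff (π b) = ∑ a : N, z.coeff ((a : H) * b) :=
    fun z b => push_coeff_aux N z b
  let J' : MonoidAlgebra ℤ (H ⧸ N) := ∑ h : H ⧸ N, MonoidAlgebra.single h (1 : ℤ)
  have hFJ : F (∑ h : H, MonoidAlgebra.single h (1 : ℤ)) = ((p : ℤ) ^ (2 * k)) • J' := by
    ext q
    obtain ⟨b, rfl⟩ := hπs q
    rw [hF, MonoidAlgebra.coeff_smul_apply, J_coeff_aux]
    simp [J_coeff_aux, hNf]
  have hyy : F x * F x = ((p : ℤ) ^ (2 * k)) • (((m : ℤ) ^ 2) • 1 - J') := by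
    rw [← map_mul, hxx, map_sub, hFJ, map_zsmul, map_one, hcard, smul_sub, smul_smul]
    congr 2
    push_cast; ring
  have hcopQ : (Nat.card (H ⧸ N)).Coprime p := by
    rw [hQc]; exact (hcopm.pow_right 2).symm
  obtain ⟨u, hu, huu⟩ := sq_dvd_pow_aux p hcopQ k (F x) _ hyy
  have hpk0 : (p : ℤ) ^ k ≠ 0 := pow_ne_zero _ (by exact_mod_cast hp.ne_zero)
  have huc : ∀ q, (F x).coeff q = (p : ℤ) ^ k * u.coeff q := by
    intro q; rw [hu, MonoidAlgebra.coeff_smul_apply, smul_eq_mul]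
  have hyinv : ∀ q, (F x).coeff q⁻¹ = (F x).coeff q := by
    intro q
    obtain ⟨b, rfl⟩ := hπs q
    rw [← map_inv, hF, hF]
    apply Fintype.sum_equiv (Equiv.inv N)
    intro a
    rw [← hxinv]
    simp [mul_comm]
  have huinv : ∀ q, u.coeff q⁻¹ = u.coeff q := by
    intro q
    apply mul_left_cancel₀ hpk0
    rw [← huc, ← huc, hyinv]
  have husum : ∑ q, u.coeff q ^ 2 = (m : ℤ) ^ 2 - 1 := by
    have h1 : (u * u).coeff 1 = ∑ q, u.coeff q ^ 2 := by
      rw [MonoidAlgebra.coeff_mul_apply_left, Finsupp.sum_fintype _ _ (by simp)]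
      apply Finset.sum_congr rfl
      intro q _
      rw [mul_one, huinv, sq]
    rw [← h1, huu, MonoidAlgebra.coeff_sub, Finsupp.sub_apply, J_coeff_aux,
      MonoidAlgebra.coeff_smul_apply, MonoidAlgebra.coeff_one_one]
    simp
  let X : H → Finset N := fun b => Finset.univ.filter (fun a : N => x.coeff ((a : H) * b) = -1)
  have hS : ∀ b, b ∉ N → (F x).coeff (π b) = (p : ℤ) ^ (2 * k) - 2 * (X b).card := by
    intro b hb
    rw [hF]
    have h1 : ∀ a : N, x.coeff ((a : H) * b) = 1 - 2 * (if x.coeff ((a : H) * b) = -1 then 1 else 0)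
        := by
      intro a
      have hne : (a : H) * b ≠ 1 := by
        intro h
        apply hb
        rw [← N.mul_mem_cancel_left a.2, h]
        exact N.one_mem
      rcases hxpm _ hne with h | h <;> rw [h] <;> norm_num
    rw [Finset.sum_congr rfl (fun a _ => h1 a), Finset.sum_sub_distrib, ← Finset.mul_sum,
      Finset.sum_boole]
    simp [X, hNf]
  have hpoddZ : Odd (p : ℤ) := by rw [Int.odd_iff]; omega
  have hodd : ∀ q, q ≠ 1 → 1 ≤ u.coeff q ^ 2 := by
    intro q hq
    obtain ⟨b, rfl⟩ := hπs q
    have hb : b ∉ N := fun h => hq ((QuotientGroup.eq_one_iff b).2 h)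
    have h1 : Odd ((F x).coeff (π b)) := by
      rw [hS b hb]
      exact (hpoddZ.pow).sub_even (even_two_mul _)
    have h2 : u.coeff (π b) ≠ 0 := by
      intro h
      rw [huc, h] at h1
      simp at h1
    have := sq_pos_of_ne_zero h2
    omega
  have hpm1 : ∀ q, q ≠ 1 → u.coeff q = 1 ∨ u.coeff q = -1 := by
    intro q hq
    have h1 : ∑ q', (if q' = 1 then (0 : ℤ) else if q' = q then u.coeff q ^ 2 else 1)
        ≤ ∑ q, u.coeff q ^ 2 := by
      apply Finset.sum_le_sum
      intro q' _
      split_ifs with h h'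
      · positivity
      · rw [h']
      · exact hodd q' h
    have h2 : ∀ q', (if q' = 1 then (0 : ℤ) else if q' = q then u.coeff q ^ 2 else 1)
        = 1 - (if q' = 1 then 1 else 0) + (if q' = q then u.coeff q ^ 2 - 1 else 0) := by
      intro q'
      by_cases h : q' = 1
      · subst h; simp [Ne.symm hq]
      · by_cases h' : q' = q <;> simp [h, h', hq]
    rw [Finset.sum_congr rfl (fun a _ => h2 a), husum, Finset.sum_add_distrib,
      Finset.sum_sub_distrib] at h1
    simp [hQf] at h1
    have h3 : u.coeff q ^ 2 = 1 := by have := hodd q hq; omega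
    exact by simpa using h3
  -- element of order prime to p
  obtain ⟨l, hl, hlm⟩ := Nat.exists_prime_and_dvd hm
  have := Fact.mk hl
  obtain ⟨b, hb⟩ := exists_prime_orderOf_dvd_card (G := H) l
    (by rw [hcard]; exact Dvd.dvd.pow (hlm.mul_left _) two_ne_zero)
  have hbm : b ^ (2 * m) = 1 := by
    rw [← orderOf_dvd_iff_pow_eq_one, hb]; exact hlm.mul_left _
  have hbN : b ∉ N := by
    intro h
    have h1 : orderOf (⟨b, h⟩ : N) ∣ p ^ (2 * k) := hNc ▸ orderOf_dvd_natCard _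
    rw [Subgroup.orderOf_mk, hb] at h1
    have h2 := (Nat.prime_dvd_prime_iff_eq hl hp).1 (hl.dvd_of_dvd_pow h1)
    exact hpm (h2 ▸ hlm)
  have hb1 : b ≠ 1 := fun h => hbN (h ▸ N.one_mem)
  have hinvar : ∀ a : N, ∀ t : ℕ, t.Coprime p → x.coeff (((a ^ t : N) : H) * b)
      = x.coeff ((a : H) * b) := by
    intro a t ht
    have hco : Nat.Coprime (p ^ (2 * k)) (2 * m) := by
      apply Nat.Coprime.pow_left
      apply Nat.Coprime.mul_right _ hcopm
      rw [hp.coprime_iff_not_dvd]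
      intro h; have := Nat.le_of_dvd (by norm_num) h; omega
    obtain ⟨t', h1, h2⟩ := Nat.chineseRemainder hco t 1
    have hp' : t'.Coprime p := by
      have h3 : t' ≡ t [MOD p] := h1.of_dvd (dvd_pow_self p (by have := hk.pos; omega))
      rw [Nat.Coprime, h3.gcd_eq]; exact ht
    have h2m : t'.Coprime (2 * m) := by
      rw [Nat.Coprime, h2.gcd_eq]; simp
    have hcop : t'.Coprime (2 * (p ^ k * m)) := by
      have : 2 * (p ^ k * m) = p ^ k * (2 * m) := by ring
      rw [this]
      exact Nat.Coprime.mul_right (hp'.pow_right k) h2m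
    rw [← hmult t' hcop ((a : H) * b), mul_pow]
    congr 2
    · rw [← Subgroup.coe_pow]
      congr 1
      rw [pow_eq_pow_iff_modEq]
      exact (h1.of_dvd (hNc ▸ orderOf_dvd_natCard a)).symm
    · conv_lhs => rw [← pow_one b]
      rw [pow_eq_pow_iff_modEq]
      exact (h2.of_dvd (orderOf_dvd_of_pow_eq_one hbm)).symm
  obtain ⟨c, hc⟩ := fiber_aux p (2 * k) hp hNc ((X b).erase 1) (by simp) (by
    intro a ha t ht
    simp only [X, Finset.mem_erase, Finset.mem_filter, Finset.mem_univ, true_and] at ha ⊢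
    refine ⟨?_, by rw [hinvar a t ht, ha.2]⟩
    intro h
    apply ha.1
    have hcop : (Nat.card N).Coprime t := by rw [hNc]; exact (ht.pow_right _).symm
    exact pow_inj_aux t hcop (by simpa using h))
  have hcz : (((X b).erase 1).card : ℤ) = ((p : ℤ) - 1) * c := by
    rw [hc]; push_cast [Nat.cast_sub hp.one_le]; ring
  have hmain := hS b hbN
  rw [huc] at hmain
  have hq1 : π b ≠ 1 := fun h => hbN ((QuotientGroup.eq_one_iff b).1 h)
  refine arith_aux p k c (u.coeff (π b)) (x.coeff b) hp4 hp5 hk (hpm1 _ hq1) (hxpm b hb1) ?_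
  have hXc : (2 * (X b).card : ℤ) = 2 * ((p - 1) * c) + (1 - x.coeff b) := by
    by_cases h1 : (1 : N) ∈ X b
    · have h2 : x.coeff b = -1 := by simpa [X] using h1
      rw [← Finset.card_erase_add_one h1, h2]
      push_cast
      rw [hcz]; ring
    · have h2 : x.coeff b = 1 := by
        have h3 : x.coeff b ≠ -1 := by simpa [X] using h1
        exact (hxpm b hb1).resolve_right h3
      rw [Finset.erase_eq_of_notMem h1] at hcz
      rw [hcz, h2]; ring
  rw [hXc] at hmain
  linarith

/-- If `G` is an abelian group of order `v = p₁^{2k₁} ⋯ pₙ^{2kₙ}` with `n ≥ 2` and the `pᵢ`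
pairwise distinct odd primes, and `G` contains a regular Paley type PDS, then `pᵢ ≡ 3 (mod 4)`
whenever `kᵢ` is odd. -/
theorem stmt0 (n : ℕ) (hn : 2 ≤ n) (p k : Fin n → ℕ)
    (hp : ∀ i, (p i).Prime) (hpodd : ∀ i, Odd (p i))
    (hpdist : Function.Injective p) (hk : ∀ i, 0 < k i)
    (hcard : Fintype.card G = ∏ i, p i ^ (2 * k i))
    (D : Finset G) (hD : IsPaleyPDS D) :
    ∀ i, Odd (k i) → p i % 4 = 3 := by
  intro i hki
  by_contra hne
  have hodd := hpodd i
  rw [Nat.odd_iff] at hodd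
  refine core_aux D hD (p i) (k i) (∏ j ∈ Finset.univ.erase i, p j ^ k j) (hp i) (by omega) hki
    ?_ ?_ ?_
  · rw [hcard, Finset.mul_prod_erase _ (fun j => p j ^ k j) (Finset.mem_univ i),
      ← Finset.prod_pow]
    apply Finset.prod_congr rfl
    intro j _
    rw [mul_comm, pow_mul]
  · intro h
    obtain ⟨j, hj, hdvd⟩ := ((hp i).prime.dvd_finsetProd_iff _).1 h
    have h1 := (Nat.prime_dvd_prime_iff_eq (hp i) (hp j)).1 ((hp i).dvd_of_dvd_pow hdvd)
    exact (Finset.mem_erase.1 hj).1 (hpdist h1).symm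
  · intro h
    have : Nontrivial (Fin n) := Fin.nontrivial_iff_two_le.2 hn
    obtain ⟨j, hj⟩ := exists_ne i
    rw [Finset.prod_eq_one_iff] at h
    have h1 := h j (Finset.mem_erase.2 ⟨hj, Finset.mem_univ j⟩)
    have h2 := Nat.one_lt_pow (hk j).ne' (hp j).one_lt
    omega
end

section
/- Let D be a regular Paley type partial difference set in a finite abelian group G whose order v = |G| is a perfect square. Let N be a non-trivial subgroup of G such that gcd(|N|, |G|/|N|) = 1, |G|/|N| is odd, and |N| ≠ 243. Then D₁ = D ∩ N is a regular Paley type partial difference set in N, i.e., D₁ is a regular (|N|, (|N|−1)/2, (|N|−5)/4, (|N|−1)/4)-partial difference set in N. -/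
open Finset

variable {G : Type*} [CommGroup G] [Fintype G] [DecidableEq G]

set_option linter.unusedSectionVars false

section core
variable {A : Type*} [AddCommGroup A] [Fintype A] [DecidableEq A]

lemma four_sq (s : A → ℤ) (hs : ∀ x, s (-x) = s x) (χ : AddChar A ℂ) :
    (∑ x, (s x : ℂ) * χ x) ^ 2 = ∑ g, ((∑ x, s (g + x) * s x : ℤ) : ℂ) * χ g := by
  have h1 : ∑ x, (s x : ℂ) * χ x = ∑ x, (s x : ℂ) * χ (-x) := by
    rw [← Equiv.sum_comp (Equiv.neg A)]
    simp [hs]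
  rw [sq]
  nth_rewrite 2 [h1]
  rw [Finset.sum_mul_sum, Finset.sum_comm]
  push_cast
  simp_rw [Finset.sum_mul]
  rw [Finset.sum_comm (s := (univ : Finset A)) (t := univ) (f := fun g x => (s (g + x) : ℂ) * s x * χ g)]
  refine Finset.sum_congr rfl fun y _ => ?_
  rw [← Equiv.sum_comp (Equiv.addRight y)]
  refine Finset.sum_congr rfl fun g _ => ?_
  have : χ g = χ (g + y) * χ (-y) := by rw [← AddChar.map_add_eq_mul]; simp
  simp only [Equiv.coe_addRight]
  rw [this]; ring

lemma four_val (s : A → ℤ) (hs : ∀ x, s (-x) = s x) (n : ℕ) (hn : Fintype.card A = n ^ 2)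
    (hc : ∀ g, ∑ x, s (g + x) * s x = if g = 0 then (n : ℤ) ^ 2 - 1 else -1) (χ : AddChar A ℂ) :
    ∃ ε : ℤ, ∑ x, (s x : ℂ) * χ x = n * ε ∧ (χ ≠ 0 → Odd ε) := by
  classical
  have h := four_sq s hs χ
  have h2 : ∀ g : A, (((if g = 0 then (n : ℤ) ^ 2 - 1 else -1 : ℤ)) : ℂ) * χ g
      = (if g = 0 then (n : ℂ) ^ 2 else 0) - χ g := by
    intro g
    split_ifs with hg
    · subst hg; simp
    · simp
  simp_rw [hc, h2] at h
  rw [Finset.sum_sub_distrib, AddChar.sum_eq_ite] at h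
  simp only [Finset.sum_ite_eq', Finset.mem_univ, if_true] at h
  by_cases hχ : χ = 0
  · rw [if_pos hχ, hn] at h
    refine ⟨0, ?_, fun h => absurd hχ h⟩
    have : (∑ x, (s x : ℂ) * χ x) ^ 2 = 0 := by rw [h]; push_cast; ring
    simpa using this
  · rw [if_neg hχ, sub_zero, sq_eq_sq_iff_eq_or_eq_neg] at h
    rcases h with h | h
    · exact ⟨1, by rw [h]; simp, fun _ => odd_one⟩
    · exact ⟨-1, by rw [h]; simp, fun _ => by decide⟩

lemma int_of_integral (z : ℂ) (hz : IsIntegral ℤ z) (q : ℚ) (h : z = q) : ∃ t : ℤ, z = t := by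
  have h1 : IsIntegral ℤ q := by
    rw [h] at hz
    exact (isIntegral_algebraMap_iff (R := ℤ) (A := ℚ) (B := ℂ) (algebraMap ℚ ℂ).injective).1 hz
  obtain ⟨t, ht⟩ := IsIntegrallyClosed.isIntegral_iff.1 h1
  refine ⟨t, ?_⟩
  rw [h, ← ht]; simp

lemma char_integral (χ : AddChar A ℂ) (x : A) : IsIntegral ℤ (χ x) := by
  refine IsIntegral.of_pow (n := Fintype.card A) Fintype.card_pos ?_
  rw [← AddChar.map_nsmul_eq_pow, card_nsmul_eq_zero, AddChar.map_zero_eq_one]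
  exact isIntegral_one

lemma exists_proj (N : AddSubgroup A) (m h : ℕ) (hm : Nat.card N = m) (hh : Nat.card (A ⧸ N) = h)
    (hmh : Nat.Coprime m h) : ∃ f : A →+ N, ∀ x : N, f x = x := by
  obtain ⟨c, hc1, hc2⟩ := Nat.chineseRemainder hmh 1 0
  have hmem : ∀ x : A, c • x ∈ N := by
    intro x
    rw [← QuotientAddGroup.eq_zero_iff, QuotientAddGroup.mk_nsmul]
    obtain ⟨d, hd⟩ := (Nat.modEq_zero_iff_dvd.1 hc2)
    rw [hd, mul_comm, mul_nsmul', ← hh]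
    have : Nat.card (A ⧸ N) • (x : A ⧸ N) = 0 := by
      have := Fintype.ofFinite (A ⧸ N)
      rw [Nat.card_eq_fintype_card]; exact card_nsmul_eq_zero
    simp [this]
  refine ⟨⟨⟨fun x => ⟨c • x, hmem x⟩, by simp⟩, by intro x y; ext; simp⟩, ?_⟩
  intro x
  ext
  simp only [AddMonoidHom.coe_mk, ZeroHom.coe_mk]
  have : c • x = 1 • x := by
    have := Fintype.ofFinite N
    rw [nsmul_eq_nsmul_iff_modEq]
    refine hc1.of_dvd ?_
    rw [← hm, Nat.card_eq_fintype_card]; exact addOrderOf_dvd_card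
  rw [one_nsmul] at this
  exact congrArg Subtype.val this

lemma core_t (s : A → ℤ) (hs : ∀ x, s (-x) = s x) (a b : ℕ) (hn : Fintype.card A = (a * b) ^ 2)
    (hc : ∀ g, ∑ x, s (g + x) * s x = if g = 0 then ((a * b : ℕ) : ℤ) ^ 2 - 1 else -1)
    (hb : Odd b) (hab : Nat.Coprime a b) (N : AddSubgroup A) [Fintype N]
    (hN : Nat.card N = a ^ 2) (hQ : Nat.card (A ⧸ N) = b ^ 2) (ψ : AddChar N ℂ) :
    ∃ t : ℤ, ∑ x : N, (s x : ℂ) * ψ x = a * t ∧ (ψ ≠ 0 → Odd t) := by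
  classical
  obtain ⟨f, hf⟩ := exists_proj N _ _ hN hQ (Nat.Coprime.pow 2 2 hab)
  have := Fintype.ofFinite (A ⧸ N)
  let Ψ : AddChar (A ⧸ N) ℂ → AddChar A ℂ := fun χ =>
    ψ.compAddMonoidHom f * χ.compAddMonoidHom (QuotientAddGroup.mk' N)
  have hΨ : ∀ χ x, Ψ χ x = ψ (f x) * χ (x : A ⧸ N) := fun χ x => rfl
  choose ε hε hεo using fun χ => four_val s hs (a * b) hn hc (Ψ χ)
  have hb0 : b ≠ 0 := by rintro rfl; simp at hb
  have hsum : ∑ χ, ∑ x, (s x : ℂ) * Ψ χ x = b ^ 2 * ∑ x : N, (s x : ℂ) * ψ x := by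
    rw [Finset.sum_comm]
    have h1 : ∀ x : A, ∑ χ, (s x : ℂ) * Ψ χ x
        = if x ∈ N then b ^ 2 * ((s x : ℂ) * ψ (f x)) else 0 := by
      intro x
      simp_rw [hΨ, ← mul_assoc]
      rw [← Finset.mul_sum, AddChar.sum_apply_eq_ite, ← Nat.card_eq_fintype_card, hQ]
      simp only [QuotientAddGroup.eq_zero_iff]
      split_ifs
      · push_cast; ring
      · simp
    simp_rw [h1]
    rw [← Finset.sum_filter, Finset.mul_sum]
    rw [Finset.sum_subtype (p := fun x => x ∈ N) (F := inferInstance) _ (by simp)]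
    refine Finset.sum_congr rfl fun x _ => ?_
    rw [hf]
  have hbz : (b : ℂ) * ∑ x : N, (s x : ℂ) * ψ x = a * (∑ χ, ε χ : ℤ) := by
    have : (b : ℂ) ≠ 0 := by exact_mod_cast hb0
    apply mul_left_cancel₀ this
    rw [← mul_assoc, ← sq, ← hsum]
    simp_rw [hε]
    rw [← Finset.mul_sum]; push_cast; ring
  have hint : IsIntegral ℤ (∑ x : N, (s x : ℂ) * ψ x) := by
    refine IsIntegral.sum _ fun x _ => IsIntegral.mul ?_ (char_integral ψ x)
    exact isIntegral_algebraMap (R := ℤ) (A := ℂ) (x := s x)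
  obtain ⟨z, hz⟩ := int_of_integral _ hint ((a : ℚ) * (∑ χ, ε χ : ℤ) / b) (by
    have : (b : ℂ) ≠ 0 := by exact_mod_cast hb0
    push_cast
    rw [eq_div_iff this, mul_comm, hbz]; push_cast; rfl)
  rw [hz] at hbz
  have hbz' : (b : ℤ) * z = a * ∑ χ, ε χ := by exact_mod_cast hbz
  have hdvd : (b : ℤ) ∣ ∑ χ, ε χ := by
    have : IsCoprime (b : ℤ) a := (Nat.isCoprime_iff_coprime.2 hab).symm
    exact this.dvd_of_dvd_mul_left ⟨z, hbz'.symm⟩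
  obtain ⟨t, ht⟩ := hdvd
  refine ⟨t, ?_, ?_⟩
  · rw [hz]
    rw [ht] at hbz'
    have : z = a * t := by
      have hb' : (b : ℤ) ≠ 0 := by exact_mod_cast hb0
      apply mul_left_cancel₀ hb'
      rw [hbz']; ring
    rw [this]; push_cast; rfl
  · intro hψ
    have hΨ0 : ∀ χ, Ψ χ ≠ 0 := by
      intro χ h0
      apply hψ
      ext x
      have := hΨ χ x
      rw [h0, hf, (QuotientAddGroup.eq_zero_iff (x : A)).2 x.2] at this
      simpa using this.symm
    have hodd : Odd (∑ χ, ε χ) := by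
      have h1 : (2 : ℤ) ∣ ∑ χ, (ε χ - 1) := by
        refine Finset.dvd_sum fun χ _ => ?_
        obtain ⟨r, hr⟩ := hεo χ (hΨ0 χ)
        exact ⟨r, by rw [hr]; ring⟩
      rw [Finset.sum_sub_distrib, Finset.sum_const, Finset.card_univ, AddChar.card_eq,
        ← Nat.card_eq_fintype_card, hQ, nsmul_eq_mul, mul_one] at h1
      have h2 : Odd (((b ^ 2 : ℕ)) : ℤ) := by exact_mod_cast hb.pow
      obtain ⟨r, hr⟩ := h1
      obtain ⟨q, hq⟩ := h2
      exact ⟨r + q, by linarith⟩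
    rw [ht] at hodd
    exact (Int.odd_mul.1 hodd).2

lemma four_inv (s : A → ℤ) (hs : ∀ x, s (-x) = s x) (g : A) :
    ∑ ψ : AddChar A ℂ, (∑ x, (s x : ℂ) * ψ x) ^ 2 * ψ (-g)
      = Fintype.card A * ((∑ x, s (g + x) * s x : ℤ) : ℂ) := by
  simp_rw [four_sq s hs, Finset.sum_mul]
  rw [Finset.sum_comm]
  have : ∀ y : A, ∑ ψ : AddChar A ℂ, ((∑ x, s (y + x) * s x : ℤ) : ℂ) * ψ y * ψ (-g)
     = if y = g then Fintype.card A * ((∑ x, s (y + x) * s x : ℤ) : ℂ) else 0 := by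
    intro y
    simp_rw [mul_assoc, ← AddChar.map_add_eq_mul]
    rw [← Finset.mul_sum, AddChar.sum_apply_eq_ite]
    simp only [← sub_eq_add_neg, sub_eq_zero]
    split_ifs
    · ring
    · simp
  simp_rw [this]
  simp

lemma core_back (s : A → ℤ) (hs : ∀ x, s (-x) = s x) (a : ℕ) (ha : a ≠ 0)
    (hn : Fintype.card A = a ^ 2) (h0 : ∑ x, s x * s x = (a : ℤ) ^ 2 - 1)
    (ht : ∀ ψ : AddChar A ℂ, ∃ t : ℤ, ∑ x, (s x : ℂ) * ψ x = a * t ∧ (ψ ≠ 0 → Odd t)) :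
    ∑ x, s x = 0 ∧ ∀ g, ∑ x, s (g + x) * s x = if g = 0 then (a : ℤ) ^ 2 - 1 else -1 := by
  classical
  choose t ht hto using ht
  have ha' : (a : ℂ) ≠ 0 := by exact_mod_cast ha
  have hinv : ∀ g, ∑ ψ : AddChar A ℂ, ((t ψ) ^ 2 : ℂ) * ψ (-g)
      = ((∑ x, s (g + x) * s x : ℤ) : ℂ) := by
    intro g
    have := four_inv s hs g
    simp_rw [ht, mul_pow, mul_assoc] at this
    rw [← Finset.mul_sum, hn] at this
    push_cast at this ⊢
    exact mul_left_cancel₀ (pow_ne_zero 2 ha') this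
  have hsum : ∑ ψ, (t ψ) ^ 2 = (a : ℤ) ^ 2 - 1 := by
    have := hinv 0
    simp only [neg_zero, AddChar.map_zero_eq_one, mul_one, zero_add, h0] at this
    exact_mod_cast this
  have hge : ∀ ψ ∈ univ.erase (0 : AddChar A ℂ), 1 ≤ (t ψ) ^ 2 := by
    intro ψ hψ
    have := hto ψ (Finset.ne_of_mem_erase hψ)
    have h1 : t ψ ≠ 0 := by rintro h; rw [h] at this; simp at this
    have := sq_pos_of_ne_zero h1
    omega
  have hcard : ∑ ψ ∈ univ.erase (0 : AddChar A ℂ), (1 : ℤ) = (a : ℤ) ^ 2 - 1 := by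
    rw [Finset.sum_const, Finset.card_erase_of_mem (mem_univ _), Finset.card_univ, AddChar.card_eq,
      hn, nsmul_eq_mul, mul_one, Nat.cast_sub (Nat.one_le_pow _ _ (Nat.pos_of_ne_zero ha))]
    push_cast; rfl
  have hle := Finset.sum_le_sum hge
  rw [← Finset.add_sum_erase _ _ (mem_univ (0 : AddChar A ℂ))] at hsum
  have hz : t 0 ^ 2 = 0 := by
    have := sq_nonneg (t 0)
    linarith
  have heq : ∑ ψ ∈ univ.erase (0 : AddChar A ℂ), (1 : ℤ)
      = ∑ ψ ∈ univ.erase (0 : AddChar A ℂ), (t ψ) ^ 2 := by linarith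
  have hall := (Finset.sum_eq_sum_iff_of_le hge).1 heq
  constructor
  · have := ht 0
    rw [pow_eq_zero_iff (two_ne_zero)] at hz
    rw [hz] at this
    simp only [AddChar.zero_apply, mul_one, Int.cast_zero, mul_zero] at this
    exact_mod_cast this
  · intro g
    have h1 := hinv g
    have h2 : ∀ ψ : AddChar A ℂ, ((t ψ) ^ 2 : ℂ) * ψ (-g) = ψ (-g) - if ψ = 0 then 1 else 0 := by
      intro ψ
      split_ifs with h
      · subst h
        have : ((t 0) ^ 2 : ℂ) = 0 := by exact_mod_cast hz
        rw [this]; simp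
      · have : ((t ψ) ^ 2 : ℂ) = 1 := by
          exact_mod_cast (hall ψ (Finset.mem_erase.2 ⟨h, mem_univ _⟩)).symm
        rw [this]; simp
    simp_rw [h2] at h1
    rw [Finset.sum_sub_distrib, AddChar.sum_apply_eq_ite, hn] at h1
    simp only [Finset.sum_ite_eq', Finset.mem_univ, if_true, neg_eq_zero] at h1
    split_ifs at h1 ⊢ with hg
    · push_cast at h1; exact_mod_cast h1.symm
    · rw [zero_sub] at h1; exact_mod_cast h1.symm

end core

section comb

/-- The `{0,1,-1}`-valued function attached to `D`. -/
def sg (D : Finset G) (x : G) : ℤ :=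
  2 * (if x ∈ D then 1 else 0) + (if x = 1 then 1 else 0) - 1

lemma sg_sum (D : Finset G) : ∑ x, sg D x = 2 * (D.card : ℤ) + 1 - Fintype.card G := by
  unfold sg
  rw [Finset.sum_sub_distrib, Finset.sum_add_distrib, ← Finset.mul_sum]
  simp

lemma sg_conv (D : Finset G) (hinv : ∀ d : G, d ∈ D ↔ d⁻¹ ∈ D) (g : G) :
    ∑ x, sg D (g * x) * sg D x
      = 4 * (∑ x, (if g * x ∈ D then 1 else 0) * (if x ∈ D then 1 else 0)) +
        4 * (if g ∈ D then 1 else 0) + (if g = 1 then 1 else 0) - 4 * (D.card : ℤ) - 2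
        + Fintype.card G := by
  have h1 : ∀ x : G, sg D (g * x) * sg D x =
      4 * ((if g * x ∈ D then 1 else 0) * (if x ∈ D then 1 else 0))
      + (if x = 1 then 2 * (if g * x ∈ D then 1 else 0) else 0)
      + (if x = g⁻¹ then 2 * (if x ∈ D then 1 else 0) else 0)
      + (if x = 1 then (if g * x = 1 then 1 else 0) else 0)
      - 2 * (if g * x ∈ D then 1 else 0) - 2 * (if x ∈ D then 1 else 0)
      - (if x = 1 then 1 else 0) - (if x = g⁻¹ then 1 else 0) + 1 := by
    intro x
    have h : g * x = 1 ↔ x = g⁻¹ := by rw [mul_comm, mul_eq_one_iff_eq_inv]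
    simp only [sg, h]
    split_ifs <;> ring
  have h2 : ∑ x : G, (if g * x ∈ D then (1 : ℤ) else 0) = D.card := by
    refine (Equiv.sum_comp (Equiv.mulLeft g) (fun x => if x ∈ D then (1 : ℤ) else 0)).trans ?_
    simp
  simp_rw [h1]
  simp only [Finset.sum_add_distrib, Finset.sum_sub_distrib, ← Finset.mul_sum, h2,
    Finset.sum_ite_eq', Finset.mem_univ, if_true, ← hinv, mul_one]
  simp
  split_ifs <;> ring

lemma count_eq (D : Finset G) (g : G) (hg : g ≠ 1) :
    (((D ×ˢ D).filter (fun x => x.1 ≠ x.2 ∧ x.1 * x.2⁻¹ = g)).card : ℤ)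
      = ∑ x, (if g * x ∈ D then 1 else 0) * (if x ∈ D then 1 else 0) := by
  have h1 : ∀ x : G, (if g * x ∈ D then (1 : ℤ) else 0) * (if x ∈ D then 1 else 0)
      = if (g * x ∈ D ∧ x ∈ D) then 1 else 0 := by
    intro x; split_ifs <;> simp_all
  simp_rw [h1]
  rw [Finset.sum_boole, Nat.cast_inj]
  refine Finset.card_bij' (fun x _ => x.2) (fun x _ => (g * x, x)) ?_ ?_ ?_ ?_
  · rintro ⟨x, y⟩ h
    simp only [Finset.mem_filter, Finset.mem_product, Finset.mem_univ, true_and] at h ⊢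
    obtain ⟨⟨hx, hy⟩, -, rfl⟩ := h
    simpa using ⟨hx, hy⟩
  · intro x h
    simp only [Finset.mem_filter, Finset.mem_product, Finset.mem_univ, true_and] at h ⊢
    refine ⟨h, ?_, by simp⟩
    simpa using hg
  · rintro ⟨x, y⟩ h
    simp only [Finset.mem_filter, Finset.mem_product] at h
    obtain ⟨-, -, rfl⟩ := h
    simp
  · intro x h; rfl

lemma sg_inv (D : Finset G) (hinv : ∀ d : G, d ∈ D ↔ d⁻¹ ∈ D) (x : G) :
    sg D x⁻¹ = sg D x := by
  simp [sg, ← hinv]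

lemma sg_sq (D : Finset G) (h1 : (1 : G) ∉ D) : ∑ x, sg D x * sg D x = (Fintype.card G : ℤ) - 1 := by
  have : ∀ x, sg D x * sg D x = 1 - if x = 1 then 1 else 0 := by
    intro x
    by_cases hx : x = 1
    · subst hx; simp [sg, h1]
    · by_cases hd : x ∈ D <;> simp [sg, hx, hd]
  simp_rw [this]
  simp

lemma paley_conv (D : Finset G) (hD : IsPaleyPDS D) (g : G) :
    ∑ x, sg D (g * x) * sg D x = if g = 1 then (Fintype.card G : ℤ) - 1 else -1 := by
  obtain ⟨k, l, m, ⟨⟨-, hk, hl, hm⟩, hinv, h1⟩, e1, e2, e3⟩ := hD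
  split_ifs with hg
  · subst hg; simpa using sg_sq D h1
  · rw [sg_conv D hinv, ← count_eq D g hg]
    by_cases hd : g ∈ D
    · rw [hl g hg hd]; simp [hg, hd, hk]; omega
    · rw [hm g hg hd]; simp [hg, hd, hk]; omega

lemma paley_of_conv (D : Finset G) (hinv : ∀ d : G, d ∈ D ↔ d⁻¹ ∈ D) (h1 : (1 : G) ∉ D)
    (l : ℕ) (hl : Fintype.card G = 4 * l + 5) (hs : ∑ x, sg D x = 0)
    (hc : ∀ g, g ≠ 1 → ∑ x, sg D (g * x) * sg D x = -1) : IsPaleyPDS D := by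
  rw [sg_sum] at hs
  refine ⟨D.card, l, l + 1, ⟨⟨rfl, rfl, ?_, ?_⟩, hinv, h1⟩, by omega, hl, by omega⟩
  · intro g hg hd
    have := hc g hg
    rw [sg_conv D hinv, ← count_eq D g hg] at this
    simp only [hg, hd, if_true, if_false] at this
    omega
  · intro g hg hd
    have := hc g hg
    rw [sg_conv D hinv, ← count_eq D g hg] at this
    simp only [hg, hd, if_false] at this
    omega

end comb

/-- If `D` is a regular Paley type PDS in an abelian group `G` whose order is a perfect
square, and `N` is a non-trivial subgroup with `gcd(|N|, |G|/|N|) = 1`, `|G|/|N|` odd and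
`|N| ≠ 243`, then `D ∩ N` is a regular Paley type PDS in `N`. -/
theorem stmt1 (D : Finset G) (hD : IsPaleyPDS D) (hsq : IsSquare (Fintype.card G))
    (N : Subgroup G) [DecidablePred (· ∈ N)] (hNnt : N ≠ ⊥)
    (hgcd : Nat.gcd (Fintype.card N) (Fintype.card G / Fintype.card N) = 1)
    (hodd : Odd (Fintype.card G / Fintype.card N))
    (h243 : Fintype.card N ≠ 243) :
    IsPaleyPDS (D.subtype (· ∈ N)) := by
  classical
  have hconv := paley_conv D hD
  obtain ⟨k, l, m, ⟨⟨-, hk, -, -⟩, hinv, h1⟩, e1, e2, e3⟩ := hD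
  have hNc : Fintype.card N * (Fintype.card G / Fintype.card N) = Fintype.card G :=
    Nat.mul_div_cancel' (by simpa [Nat.card_eq_fintype_card] using Subgroup.card_subgroup_dvd_card N)
  obtain ⟨n, hn⟩ := hsq
  have hsqN : ∃ a, Fintype.card N = a ^ 2 :=
    exists_eq_pow_of_mul_eq_pow (Nat.isUnit_iff.2 hgcd) (hNc.trans (hn.trans (sq n).symm))
  have hsqQ : ∃ b, Fintype.card G / Fintype.card N = b ^ 2 :=
    exists_eq_pow_of_mul_eq_pow (Nat.isUnit_iff.2 ((Nat.gcd_comm _ _).trans hgcd))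
      ((mul_comm _ _).trans (hNc.trans (hn.trans (sq n).symm)))
  obtain ⟨a, ha⟩ := hsqN
  obtain ⟨b, hb⟩ := hsqQ
  have hG : Fintype.card G = (a * b) ^ 2 := by rw [← hNc, hb, ha]; ring
  have hab : Nat.Coprime a b := by
    rw [hb, ha] at hgcd
    exact (Nat.coprime_pow_left_iff two_pos _ _).1 ((Nat.coprime_pow_right_iff two_pos _ _).1 hgcd)
  have hoddG : Odd ((a * b) ^ 2) := hG ▸ ⟨k, e1⟩
  have hoddab : Odd (a * b) := (Nat.odd_pow_iff two_ne_zero).1 hoddG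
  have hao : Odd a := (Nat.odd_mul.1 hoddab).1
  have hbo : Odd b := (Nat.odd_mul.1 hoddab).2
  have ha1 : a ≠ 1 := by
    rintro rfl
    apply hNnt
    rw [← Subgroup.card_eq_one, Nat.card_eq_fintype_card, ha]; rfl
  have hlN : ∃ l, Fintype.card N = 4 * l + 5 := by
    obtain ⟨r, rfl⟩ := hao
    obtain ⟨q, rfl⟩ : ∃ q, r = q + 1 := Nat.exists_eq_succ_of_ne_zero (by rintro rfl; simp at ha1)
    exact ⟨q ^ 2 + 3 * q + 1, by rw [ha]; ring⟩
  obtain ⟨lN, hlN⟩ := hlN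
  have hNs : Nat.card N = a ^ 2 := by rw [Nat.card_eq_fintype_card, ha]
  have hQs : Nat.card (G ⧸ N) = b ^ 2 := by
    have := Subgroup.card_eq_card_quotient_mul_card_subgroup N
    rw [Nat.card_eq_fintype_card (α := G), hG, hNs] at this
    have ha0 : 0 < a ^ 2 := pow_pos hao.pos 2
    apply Nat.eq_of_mul_eq_mul_right ha0
    rw [← this]; ring
  have hsgN : ∀ x : N, sg (D.subtype (· ∈ N)) x = sg D (x : G) := by
    intro x
    simp [sg]
  have hinvN : ∀ d : N, d ∈ D.subtype (· ∈ N) ↔ d⁻¹ ∈ D.subtype (· ∈ N) := by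
    intro d
    simp only [Finset.mem_subtype, Subgroup.coe_inv]
    exact hinv d
  have h1N : (1 : N) ∉ D.subtype (· ∈ N) := by simpa using h1
  have ht := @core_t (Additive G) _ (inferInstanceAs (Fintype G))
    (inferInstanceAs (DecidableEq G)) (fun x => sg D x.toMul) (fun x => sg_inv D hinv x.toMul) a b
    hG (fun g => by
      have := hconv g.toMul
      rw [hG] at this
      exact_mod_cast this) hbo hab N.toAddSubgroup
    (inferInstanceAs (Fintype N)) hNs hQs
  have hback := @core_back (Additive N) _ (inferInstanceAs (Fintype N))
    (inferInstanceAs (DecidableEq N)) (fun x => sg (D.subtype (· ∈ N)) x.toMul)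
    (fun x => sg_inv _ hinvN x.toMul) a hao.pos.ne' ha
    (by
      have := sg_sq _ h1N
      rw [ha] at this
      exact_mod_cast this)
    (by
      intro ψ
      obtain ⟨t, h2, h3⟩ := ht ψ
      refine ⟨t, ?_, h3⟩
      rw [← h2]
      refine Finset.sum_congr rfl fun x _ => ?_
      exact congrArg (fun z : ℤ => (z : ℂ) * ψ x) (hsgN x))
  refine paley_of_conv _ hinvN h1N lN hlN hback.1 ?_
  intro g hg
  have := hback.2 (Additive.ofMul g)
  rw [if_neg (by simpa using hg)] at this
  exact this
end

section
/- Let D be a nontrivial regular (v,k,λ,μ)-partial difference set in a finite abelian group G, and assume that Δ = (λ−μ)² + 4(k−μ) is not a perfect square. Then D is of Paley type; more precisely, there exist a prime p ≡ 1 (mod 4) and a non-negative integer s such that (v, k, λ, μ) = (p^{2s+1}, (p^{2s+1}−1)/2, (p^{2s+1}−5)/4, (p^{2s+1}−1)/4). -/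
open Finset

variable {G : Type*} [CommGroup G] [Fintype G] [DecidableEq G]

/-- A regular PDS is trivial if `D ∪ {1}` or `G \ D` is a subgroup of `G`. -/
def IsTrivialPDS (D : Finset G) : Prop :=
  (∃ S : Subgroup G, (S : Set G) = ↑D ∪ {1}) ∨
  (∃ S : Subgroup G, (S : Set G) = Set.univ \ ↑D)

lemma sum_sq_pds {D : Finset G} {v k l m : ℕ} (hD : IsRegularPDS D v k l m)
    {R : Type*} [CommRing R] (f : G →* R) :
    (∑ d ∈ D, f d) ^ 2 = (m : R) * ∑ g, f g + ((l : R) - m) * ∑ d ∈ D, f d + ((k : R) - m) := by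
  obtain ⟨⟨-, hk, hl, hm⟩, hinv, h1⟩ := hD
  have e1 : ∑ d ∈ D, f d = ∑ d ∈ D, f d⁻¹ := by
    refine Finset.sum_nbij' (fun x => x⁻¹) (fun x => x⁻¹) ?_ ?_ ?_ ?_ ?_
    · intro a ha; exact (hinv a).1 ha
    · intro a ha; exact (hinv a).1 ha
    · simp
    · simp
    · simp
  have e2 : (∑ d ∈ D, f d) ^ 2 = ∑ x ∈ D ×ˢ D, f (x.1 * x.2⁻¹) := by
    rw [sq]
    nth_rw 2 [e1]
    rw [Finset.sum_mul_sum, Finset.sum_product]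
    simp
  have e3 : ∑ x ∈ D ×ˢ D, f (x.1 * x.2⁻¹)
      = ∑ g, (((D ×ˢ D).filter (fun x => x.1 * x.2⁻¹ = g)).card : R) * f g := by
    rw [← Finset.sum_fiberwise (s := D ×ˢ D) (g := fun x => x.1 * x.2⁻¹)]
    refine Finset.sum_congr rfl fun g _ => ?_
    rw [← nsmul_eq_mul, ← Finset.sum_const]
    refine Finset.sum_congr rfl fun x hx => ?_
    rw [(Finset.mem_filter.1 hx).2]
  have e4 : ∀ g, (((D ×ˢ D).filter (fun x => x.1 * x.2⁻¹ = g)).card : R)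
      = (m : R) + ((l : R) - m) * (if g ∈ D then 1 else 0) + ((k:R) - m) * (if g = 1 then 1 else 0) := by
    intro g
    by_cases hg : g = 1
    · subst hg
      have : (D ×ˢ D).filter (fun x => x.1 * x.2⁻¹ = 1) = D.diag := by
        ext ⟨a, b⟩
        simp only [Finset.mem_filter, Finset.mem_product, Finset.mem_diag, mul_inv_eq_one]
        constructor
        · rintro ⟨⟨h, _⟩, h'⟩; exact ⟨h, h'⟩
        · rintro ⟨h, rfl⟩; exact ⟨⟨h, h⟩, rfl⟩
      rw [this, Finset.diag_card, hk]
      simp [h1]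
    · have : (D ×ˢ D).filter (fun x => x.1 * x.2⁻¹ = g)
          = (D ×ˢ D).filter (fun x => x.1 ≠ x.2 ∧ x.1 * x.2⁻¹ = g) := by
        refine Finset.filter_congr fun x _ => ?_
        constructor
        · intro h
          refine ⟨fun h' => hg ?_, h⟩
          rw [← h, h', mul_inv_cancel]
        · exact fun h => h.2
      rw [this]
      by_cases hgD : g ∈ D
      · rw [hl g hg hgD]; simp [hgD, hg]
      · rw [hm g hg hgD]; simp [hgD, hg]
  rw [e2, e3]
  simp_rw [e4, add_mul, Finset.sum_add_distrib, mul_assoc, ← Finset.mul_sum]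
  simp [Finset.sum_ite_mem]

lemma groupRing_descent {Q : Type*} [CommGroup Q] [Fintype Q] [Nontrivial Q] (p : ℕ)
    [hp : Fact p.Prime] (hQ : ¬ p ∣ Nat.card Q) (j : ℕ) :
    ∀ (c n : ℤ), ¬ (p : ℤ) ∣ c → ∀ U : MonoidAlgebra ℤ Q,
      U ^ 2 ≠ ((p : ℤ) ^ (2 * j + 1) * c) •
        (n • (1 : MonoidAlgebra ℤ Q) - ∑ g : Q, MonoidAlgebra.of ℤ Q g) := by
  classical
  have hp0 : (p : ℤ) ≠ 0 := by exact_mod_cast hp.out.ne_zero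
  have red : IsReduced (MonoidAlgebra (ZMod p) Q) := by
    have : NeZero (Nat.card Q : ZMod p) := ⟨by rwa [Ne, ZMod.natCast_eq_zero_iff]⟩
    have : IsSemisimpleRing (MonoidAlgebra (ZMod p) Q) := by
      unfold IsSemisimpleRing; infer_instance
    infer_instance
  -- divisibility step
  have step : ∀ (c : ℤ) (V U : MonoidAlgebra ℤ Q), U ^ 2 = ((p : ℤ) * c) • V →
      ∃ W : MonoidAlgebra ℤ Q, U = (p : ℤ) • W := by
    intro c V U h
    have h2 : (MonoidAlgebra.mapRingHom Q (Int.castRingHom (ZMod p)) U) ^ 2 = 0 := by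
      rw [← map_pow, h, map_zsmul]
      ext g
      rw [MonoidAlgebra.coeff_smul_apply]
      simp [zsmul_eq_mul]
    have h3 := pow_eq_zero_iff (two_ne_zero) |>.1 h2
    have h4 : ∀ g, (p : ℤ) ∣ U.coeff g := by
      intro g
      have := congrArg (fun x => MonoidAlgebra.coeff x g) h3
      simpa [ZMod.intCast_zmod_eq_zero_iff_dvd] using this
    choose w hw using h4
    refine ⟨MonoidAlgebra.ofCoeff (Finsupp.equivFunOnFinite.symm w), ?_⟩
    ext g
    rw [MonoidAlgebra.coeff_smul_apply]
    simp [hw]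
  have cf : ∀ (n : ℤ) (g : Q), g ≠ 1 →
      (n • (1 : MonoidAlgebra ℤ Q) - ∑ g : Q, MonoidAlgebra.of ℤ Q g).coeff g = -1 := by
    intro n g hg
    simp [MonoidAlgebra.one_def, Finsupp.single_apply, hg.symm, MonoidAlgebra.coeff_sum]
  obtain ⟨g, hg⟩ := exists_ne (1 : Q)
  induction j with
  | zero =>
    intro c n hc U hU
    obtain ⟨W, rfl⟩ := step c _ U (by simpa using hU)
    have := congrArg (fun x => MonoidAlgebra.coeff x g) hU
    simp only [smul_pow, MonoidAlgebra.coeff_smul_apply, cf n g hg, smul_eq_mul] at this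
    apply hc
    refine ⟨-(W ^ 2).coeff g, ?_⟩
    apply mul_left_cancel₀ hp0
    linear_combination this
  | succ j ih =>
    intro c n hc U hU
    obtain ⟨W, rfl⟩ := step (p ^ (2 * j + 2) * c) _ U (by rw [hU]; congr 1; ring)
    refine ih c n hc W ?_
    ext x
    have := congrArg (fun y => MonoidAlgebra.coeff y x) hU
    simp only [smul_pow, MonoidAlgebra.coeff_smul_apply, smul_eq_mul] at this ⊢
    apply mul_left_cancel₀ (pow_ne_zero 2 hp0)
    linear_combination this

lemma exists_odd_prime {v : ℕ} (hv : ¬ IsSquare v) :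
    ∃ p j n : ℕ, p.Prime ∧ ¬ p ∣ n ∧ v = p ^ (2 * j + 1) * n := by
  have hv0 : v ≠ 0 := by rintro rfl; exact hv ⟨0, rfl⟩
  obtain ⟨a, b, hab, hsq⟩ := Nat.sq_mul_squarefree v
  have ha1 : a ≠ 1 := by
    rintro rfl
    exact hv ⟨b, by rw [← hab]; ring⟩
  obtain ⟨p, hp, c, rfl⟩ := Nat.exists_prime_and_dvd ha1
  have hpc : ¬ p ∣ c := by
    rintro ⟨d, rfl⟩
    have := hsq p ⟨d, by ring⟩
    exact hp.one_lt.ne' (Nat.isUnit_iff.1 this)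
  have hb0 : b ≠ 0 := by rintro rfl; simp at hab; exact hv0 hab.symm
  obtain ⟨j, e, he, rfl⟩ := Nat.exists_eq_pow_mul_and_not_dvd hb0 p hp.ne_one
  refine ⟨p, j, e ^ 2 * c, hp, ?_, ?_⟩
  · intro h
    rcases hp.dvd_mul.1 h with h | h
    · exact he (hp.dvd_of_dvd_pow h)
    · exact hpc h
  · rw [← hab]; ring

lemma pds_params {D : Finset G} {v k l m : ℕ} (hD : IsRegularPDS D v k l m)
    (hk0 : 0 < k) (hkv : k + 1 < v)
    (hΔ : ¬ IsSquare (((l : ℤ) - m) ^ 2 + 4 * ((k : ℤ) - m))) :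
    v = 2 * k + 1 ∧ v = 4 * l + 5 ∧ v = 4 * m + 1 := by
  classical
  have hv : Fintype.card G = v := hD.1.1
  have hk : D.card = k := hD.1.2.1
  have h1 : (1 : G) ∉ D := hD.2.2
  let f : AddChar (Additive G) ℂ → G →* ℂ := fun ψ =>
    { toFun := fun g => ψ (Additive.ofMul g)
      map_one' := by simp
      map_mul' := fun a b => by rw [ofMul_mul, AddChar.map_add_eq_mul] }
  have hf : ∀ ψ g, f ψ g = ψ (Additive.ofMul g) := fun _ _ => rfl
  set β : ℤ := (l : ℤ) - m with hβ
  set Δ : ℤ := β ^ 2 + 4 * ((k : ℤ) - m) with hΔd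
  obtain ⟨r, hr⟩ : ∃ r : ℂ, r ^ 2 = (Δ : ℂ) :=
    ⟨(Δ : ℂ) ^ (1 / 2 : ℂ), by simp [← Complex.cpow_nat_mul]⟩
  have key : ∀ ψ : AddChar (Additive G) ℂ, ∃ ε : ℤ, ψ ≠ 0 →
      2 * ∑ d ∈ D, f ψ d = β + ε * r := by
    intro ψ
    by_cases hψ : ψ = 0
    · exact ⟨0, fun h => absurd hψ h⟩
    have hs := sum_sq_pds hD (f ψ)
    have h0 : ∑ g, f ψ g = 0 := by
      have : ∑ g, ψ g = 0 := AddChar.sum_eq_zero_iff_ne_zero.2 hψ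
      rw [← this]
      exact Fintype.sum_equiv Additive.ofMul _ _ (fun _ => rfl)
    rw [h0] at hs
    have : (2 * ∑ d ∈ D, f ψ d - β) ^ 2 = r ^ 2 := by
      rw [hr, hΔd, hβ]; push_cast
      linear_combination 4 * hs
    rcases sq_eq_sq_iff_eq_or_eq_neg.1 this with h | h
    · exact ⟨1, fun _ => by push_cast; linear_combination h⟩
    · exact ⟨-1, fun _ => by push_cast; linear_combination h⟩
  choose ε hε using key
  have tot : ∑ ψ : AddChar (Additive G) ℂ, 2 * ∑ d ∈ D, f ψ d = 0 := by
    rw [← Finset.mul_sum, Finset.sum_comm]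
    rw [Finset.sum_eq_zero, mul_zero]
    intro d hd
    simp only [hf]
    rw [AddChar.sum_apply_eq_ite, if_neg]
    intro h
    exact h1 (by rw [ofMul_eq_zero] at h; rwa [h] at hd)
  have hcard : Fintype.card (AddChar (Additive G) ℂ) = v := by
    rw [AddChar.card_eq, Fintype.card_additive, hv]
  rw [← Finset.add_sum_erase _ _ (Finset.mem_univ (0 : AddChar (Additive G) ℂ)),
    Finset.sum_congr rfl (fun ψ hψ => hε ψ (Finset.ne_of_mem_erase hψ)),
    Finset.sum_add_distrib, ← Finset.sum_mul, Finset.sum_const,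
    Finset.card_erase_of_mem (Finset.mem_univ _), Finset.card_univ, hcard] at tot
  simp only [hf, AddChar.zero_apply, Finset.sum_const, hk, nsmul_eq_mul, mul_one] at tot
  rw [Nat.cast_sub (by omega)] at tot
  set E : ℤ := ∑ ψ ∈ Finset.univ.erase (0 : AddChar (Additive G) ℂ), ε ψ with hE
  have hEc : ∑ ψ ∈ Finset.univ.erase (0 : AddChar (Additive G) ℂ), (ε ψ : ℂ) = E := by
    rw [hE]; push_cast; rfl
  rw [hEc] at tot
  have hsq : (2 * (k : ℤ) + (v - 1) * β) ^ 2 = E ^ 2 * Δ := by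
    have : ((2 * (k : ℂ) + (v - 1) * β)) ^ 2 = E ^ 2 * Δ := by
      rw [← hr]
      push_cast at tot
      linear_combination (2 * (k : ℂ) + (v - 1) * β - E * r) * tot
    exact_mod_cast this
  have hE0 : E = 0 := by
    by_contra hne
    apply hΔ
    have : E ∣ 2 * (k : ℤ) + (v - 1) * β := (Int.pow_dvd_pow_iff two_ne_zero).1 ⟨_, hsq⟩
    obtain ⟨t, ht⟩ := this
    refine ⟨t, ?_⟩
    rw [ht] at hsq
    apply mul_left_cancel₀ (pow_ne_zero 2 hne)
    linear_combination -hsq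
  rw [hE0] at hsq
  have h2 : 2 * (k : ℤ) + (v - 1) * β = 0 := by
    have : (2 * (k : ℤ) + (v - 1) * β) ^ 2 = 0 := by rw [hsq]; ring
    exact pow_eq_zero_iff (two_ne_zero) |>.1 this
  have hb : β = -1 := by
    have a1 : (0 : ℤ) < k := by exact_mod_cast hk0
    have a2 : (k : ℤ) + 1 < v := by exact_mod_cast hkv
    have b1 : β < 0 := by by_contra h; nlinarith
    have b2 : -2 < β := by by_contra h; nlinarith
    omega
  rw [hb] at h2
  have h3 := sum_sq_pds hD (1 : G →* ℤ)
  simp only [MonoidHom.one_apply, Finset.sum_const, hk, Finset.card_univ, hv, nsmul_eq_mul,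
    mul_one] at h3
  rw [← hβ, hb] at h3
  have hvk : (v : ℤ) = 2 * k + 1 := by linarith
  have h4 : (k : ℤ) = 2 * m := by
    have : (k : ℤ) ≠ 0 := by omega
    apply mul_left_cancel₀ this
    rw [hvk] at h3
    linear_combination h3
  omega

lemma paley_not_composite {D : Finset G} {v k l m : ℕ} (hD : IsRegularPDS D v k l m)
    (h1 : v = 2 * k + 1) (h2 : v = 4 * l + 5) (h3 : v = 4 * m + 1)
    {p j n : ℕ} (hp : p.Prime) (hn : ¬ p ∣ n) (hv : v = p ^ (2 * j + 1) * n) : n = 1 := by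
  classical
  by_contra hn1
  have hG : Fintype.card G = v := hD.1.1
  have hk : D.card = k := hD.1.2.1
  have : Fact p.Prime := ⟨hp⟩
  let P : Sylow p G := default
  have hn0 : n ≠ 0 := by rintro rfl; simp at hn
  have hP : Nat.card (P : Subgroup G) = p ^ (2 * j + 1) := by
    have := P.card_eq_multiplicity
    rw [Nat.card_eq_fintype_card (α := G), hG, hv,
      Nat.factorization_mul (pow_ne_zero _ hp.ne_zero) hn0] at this
    rw [this]
    simp [hp.factorization_self, Nat.factorization_eq_zero_of_not_dvd hn]
  let Q := G ⧸ (P : Subgroup G)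
  have hQ : Nat.card Q = n := by
    have := Subgroup.card_eq_card_quotient_mul_card_subgroup (P : Subgroup G)
    rw [hP, Nat.card_eq_fintype_card (α := G), hG, hv, mul_comm] at this
    exact (Nat.eq_of_mul_eq_mul_right (pow_pos hp.pos _) this).symm
  have : Fintype Q := Fintype.ofFinite _
  have hQ' : Fintype.card Q = n := by rw [← Nat.card_eq_fintype_card, hQ]
  have : Nontrivial Q := by
    rw [← Fintype.one_lt_card_iff_nontrivial, hQ']; omega
  let π : G →* Q := QuotientGroup.mk' (P : Subgroup G)
  have hπ : Function.Surjective π := QuotientGroup.mk'_surjective _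
  let f : G →* MonoidAlgebra ℤ Q := (MonoidAlgebra.of ℤ Q).comp π
  set T : MonoidAlgebra ℤ Q := ∑ g : Q, MonoidAlgebra.of ℤ Q g with hT
  have hTq : ∀ q : Q, T * MonoidAlgebra.of ℤ Q q = T := by
    intro q
    rw [hT, Finset.sum_mul]
    simp_rw [← map_mul]
    exact Fintype.sum_equiv (Equiv.mulRight q) _ _ (fun _ => rfl)
  have hTT : T * T = (n : MonoidAlgebra ℤ Q) * T := by
    conv_lhs => rw [hT]
    rw [← hT, hT, Finset.mul_sum, ← hT]
    simp_rw [hTq]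
    rw [Finset.sum_const, Finset.card_univ, hQ', nsmul_eq_mul]
  have hTd : T * ∑ d ∈ D, f d = (k : MonoidAlgebra ℤ Q) * T := by
    have hTf : ∀ d ∈ D, T * f d = T := fun d _ => hTq (π d)
    rw [Finset.mul_sum, Finset.sum_congr rfl hTf, Finset.sum_const, hk,
      nsmul_eq_mul]
  have hfib : ∀ q : Q, (Finset.univ.filter (fun g => π g = q)).card = p ^ (2 * j + 1) := by
    have e : ∀ q : Q, (Finset.univ.filter (fun g => π g = q)).card
        = (Finset.univ.filter (fun g => π g = 1)).card := by
      intro q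
      exact MonoidHom.card_fiber_eq_of_mem_range π (hπ q) (hπ 1)
    have e2 := Finset.card_eq_sum_card_fiberwise (f := π) (s := Finset.univ) (t := Finset.univ)
      (fun _ _ => by simp)
    rw [Finset.sum_congr rfl (fun q _ => e q), Finset.sum_const, Finset.card_univ,
      Finset.card_univ, hG, hQ', hv, smul_eq_mul, mul_comm] at e2
    intro q
    rw [e q]
    exact (Nat.eq_of_mul_eq_mul_left (Nat.pos_of_ne_zero hn0) e2).symm
  have hsum : ∑ g, f g = ((p ^ (2 * j + 1) : ℕ) : MonoidAlgebra ℤ Q) * T := by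
    rw [← Finset.sum_fiberwise (s := Finset.univ) (g := π), hT, Finset.mul_sum]
    refine Finset.sum_congr rfl fun q _ => ?_
    rw [← hfib q, ← nsmul_eq_mul, ← Finset.sum_const]
    refine Finset.sum_congr rfl fun x hx => ?_
    rw [← (Finset.mem_filter.1 hx).2]
    rfl
  have hsq := sum_sq_pds hD f
  rw [hsum] at hsq
  set d := ∑ d ∈ D, f d with hd
  set N : ℕ := p ^ (2 * j + 1) with hN
  refine groupRing_descent (Q := Q) p (by rwa [hQ]) j 1 n
    (by rw [← Int.natCast_one, Int.natCast_dvd_natCast]; exact hp.one_lt.ne' ∘ Nat.dvd_one.1)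
    (2 * d + 1 - N * T) ?_
  have c1 : (k : MonoidAlgebra ℤ Q) = 2 * m := by
    have : k = 2 * m := by omega
    rw [this]; push_cast; ring
  have c2 : (m : MonoidAlgebra ℤ Q) = l + 1 := by
    have : m = l + 1 := by omega
    rw [this]; push_cast; ring
  have c3 : (N : MonoidAlgebra ℤ Q) * n = 4 * m + 1 := by
    have : N * n = 4 * m + 1 := by omega
    have := congrArg (Nat.cast (R := MonoidAlgebra ℤ Q)) this
    push_cast at this
    exact this
  have c4 : (p : ℤ) ^ (2 * j + 1) = (N : ℤ) := by rw [hN]; push_cast; rfl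
  rw [c4, ← hT, mul_one, zsmul_eq_mul, zsmul_eq_mul]
  push_cast
  rw [c1] at hTd hsq
  linear_combination 4 * hsq - 4 * N * hTd + N ^ 2 * hTT + (N * T - 1) * c3 - 4 * d * c2

/-- (Ma, 1984) A nontrivial regular `(v,k,λ,μ)`-PDS in an abelian group with
`Δ = (λ-μ)² + 4(k-μ)` not a perfect square is of Paley type with
`v = p^{2s+1}` for a prime `p ≡ 1 (mod 4)`. -/
theorem stmt3 (D : Finset G) (v k l m : ℕ)
    (hD : IsRegularPDS D v k l m) (hnt : ¬ IsTrivialPDS D)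
    (hΔ : ¬ IsSquare (((l : ℤ) - m) ^ 2 + 4 * ((k : ℤ) - m))) :
    ∃ p s : ℕ, p.Prime ∧ p % 4 = 1 ∧ v = p ^ (2 * s + 1) ∧
      v = 2 * k + 1 ∧ v = 4 * l + 5 ∧ v = 4 * m + 1 := by
  have hv : Fintype.card G = v := hD.1.1
  have hk : D.card = k := hD.1.2.1
  have h1 : (1 : G) ∉ D := hD.2.2
  have hk0 : 0 < k := by
    rw [← hk, Finset.card_pos, Finset.nonempty_iff_ne_empty]
    rintro rfl
    exact hnt (Or.inr ⟨⊤, by simp⟩)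
  have hkv : k + 1 < v := by
    by_contra h
    apply hnt
    left
    refine ⟨⊤, ?_⟩
    have : insert 1 D = Finset.univ := by
      apply Finset.eq_univ_of_card
      have h2 := Finset.card_le_univ (insert 1 D)
      rw [Finset.card_insert_of_notMem h1] at h2 ⊢
      omega
    rw [Subgroup.coe_top, ← Finset.coe_univ, ← this]
    ext x; simp [or_comm]
  obtain ⟨h2, h3, h4⟩ := pds_params hD hk0 hkv hΔ
  have hns : ¬ IsSquare v := by
    rintro ⟨r, hr⟩
    apply hΔ
    refine ⟨r, ?_⟩
    have e1 : (l : ℤ) - m = -1 := by omega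
    have e2 : (r : ℤ) * r = v := by exact_mod_cast hr.symm
    rw [e1, e2]
    omega
  obtain ⟨p, j, n, hp, hn, hvn⟩ := exists_odd_prime hns
  have hn1 := paley_not_composite hD h2 h3 h4 hp hn hvn
  rw [hn1, mul_one] at hvn
  refine ⟨p, j, hp, ?_, hvn, h2, h3, h4⟩
  have hodd : p % 2 = 1 := by
    rcases hp.eq_two_or_odd with h | h
    · rw [h, pow_succ] at hvn; omega
    · exact h
  have hm : p ^ (2 * j + 1) % 4 = p % 4 := by
    have hp2 : p ^ 2 % 4 = 1 := by
      have : p % 4 = 1 ∨ p % 4 = 3 := by omega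
      rcases this with h | h <;> simp [Nat.pow_mod, h]
    rw [pow_succ, pow_mul, Nat.mul_mod, Nat.pow_mod, hp2]
    simp
  omega
end

section
/- (Local Multiplier Theorem) Let D be a regular (v,k,λ,μ)-partial difference set in a finite abelian group G, and assume Δ = (λ−μ)² + 4(k−μ) is a perfect square. Then for every g ∈ G and every integer s coprime with o(g), the order of g, one has g ∈ D if and only if g^s ∈ D. -/
open Finset

variable {G : Type*} [CommGroup G] [Fintype G] [DecidableEq G]

/-- The group ring element attached to a finite subset. -/
noncomputable def grpElt (p : ℕ) (D : Finset G) : MonoidAlgebra (ZMod p) G :=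
  ∑ d ∈ D, MonoidAlgebra.single d 1

lemma grpElt_coeff (p : ℕ) (D : Finset G) (g : G) :
    (grpElt p D).coeff g = if g ∈ D then 1 else 0 := by
  simp [grpElt, Finsupp.finsetSum_apply, Finsupp.single_apply]

lemma charP_grp (p : ℕ) : CharP (MonoidAlgebra (ZMod p) G) p :=
  charP_of_injective_ringHom
    (f := (MonoidAlgebra.singleOneRingHom : ZMod p →+* MonoidAlgebra (ZMod p) G))
    (MonoidAlgebra.single_right_injective) p

lemma pow_coeff (p : ℕ) [Fact p.Prime] (hp : (Fintype.card G).Coprime p)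
    (x : MonoidAlgebra (ZMod p) G) (g : G) : (x ^ p).coeff (g ^ p) = x.coeff g := by
  have := charP_grp (G := G) p
  have hinj : Function.Injective (fun y : G => y ^ p) :=
    (powCoprime (by simpa [Nat.card_eq_fintype_card] using hp)).injective
  have hx : x = ∑ h : G, MonoidAlgebra.single h (x.coeff h) := by
    ext h
    simp [Finsupp.finsetSum_apply, Finsupp.single_apply]
  conv_lhs => rw [hx]
  rw [sum_pow_char]
  simp only [MonoidAlgebra.single_pow, ZMod.pow_card, MonoidAlgebra.coeff_sum,
    MonoidAlgebra.coeff_single, Finsupp.finsetSum_apply, Finsupp.single_apply]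
  rw [Finset.sum_eq_single g]
  · simp
  · intro b _ hb
    rw [if_neg]
    intro h
    exact hb (hinj h)
  · simp

lemma pow_eq_zero_grp (p : ℕ) [Fact p.Prime] (hp : (Fintype.card G).Coprime p)
    (x : MonoidAlgebra (ZMod p) G) (hx : x ^ p = 0) : x = 0 := by
  ext g
  rw [← pow_coeff p hp x g, hx]
  simp

lemma dvd_grp (p : ℕ) [Fact p.Prime] (x : MonoidAlgebra (ZMod p) G) (c : ℤ) :
    x - (c : MonoidAlgebra (ZMod p) G) ∣ x ^ p - x := by
  have := charP_grp (G := G) p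
  have hc : (c : MonoidAlgebra (ZMod p) G) ^ p = c := by
    rw [MonoidAlgebra.intCast_def, MonoidAlgebra.single_pow, ZMod.pow_card, one_pow]
  have : x ^ p - x = (x - (c : MonoidAlgebra (ZMod p) G)) ^ p
      - (x - (c : MonoidAlgebra (ZMod p) G)) := by
    rw [sub_pow_char, hc]; ring
  rw [this]
  exact dvd_sub (dvd_pow_self _ (Fact.out : p.Prime).ne_zero) dvd_rfl

lemma grpElt_mul_univ (p : ℕ) (D : Finset G) :
    grpElt p D * grpElt p univ = (D.card : MonoidAlgebra (ZMod p) G) * grpElt p univ := by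
  have h : ∀ d : G, MonoidAlgebra.single d (1 : ZMod p) * grpElt p univ = grpElt p univ := by
    intro d
    ext g
    rw [MonoidAlgebra.coeff_single_mul_apply]
    simp [grpElt_coeff]
  conv_lhs => rw [grpElt, Finset.sum_mul]
  simp [h]

lemma grpElt_sq (p : ℕ) (D : Finset G) (v k l m : ℕ) (hD : IsRegularPDS D v k l m) :
    grpElt p D * grpElt p D = (m : MonoidAlgebra (ZMod p) G) * grpElt p univ
      + ((l : MonoidAlgebra (ZMod p) G) - (m : MonoidAlgebra (ZMod p) G)) * grpElt p D
      + ((k : MonoidAlgebra (ZMod p) G) - (m : MonoidAlgebra (ZMod p) G)) := by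
  obtain ⟨⟨-, hk, hl, hm⟩, hinv, h1⟩ := hD
  have h2 : grpElt p D = ∑ d ∈ D, MonoidAlgebra.single d⁻¹ (1 : ZMod p) := by
    rw [grpElt]
    exact Finset.sum_bij' (fun a _ => a⁻¹) (fun a _ => a⁻¹) (fun a ha => (hinv a).1 ha)
      (fun a ha => (hinv a).1 ha) (by simp) (by simp) (by simp)
  have h3 : grpElt p D * grpElt p D
      = ∑ x ∈ D ×ˢ D, MonoidAlgebra.single (x.1 * x.2⁻¹) (1 : ZMod p) := by
    calc grpElt p D * grpElt p D
        = (∑ d ∈ D, MonoidAlgebra.single d (1 : ZMod p))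
          * ∑ d ∈ D, MonoidAlgebra.single d⁻¹ (1 : ZMod p) := by rw [← h2]; rfl
      _ = _ := by
        rw [Finset.sum_mul_sum, Finset.sum_product]
        simp [MonoidAlgebra.single_mul_single]
  have hcoef : ∀ g : G, (grpElt p D * grpElt p D).coeff g
      = (((D ×ˢ D).filter (fun x => x.1 * x.2⁻¹ = g)).card : ZMod p) := by
    intro g
    rw [h3]
    simp [Finsupp.finsetSum_apply, Finsupp.single_apply]
  have hc : ∀ (n : ℕ) (x : MonoidAlgebra (ZMod p) G) (g : G),
      ((n : MonoidAlgebra (ZMod p) G) * x).coeff g = n * x.coeff g := by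
    intro n x g
    rw [MonoidAlgebra.natCast_def, MonoidAlgebra.coeff_single_one_mul]
  ext g
  rw [hcoef, sub_mul]
  simp only [MonoidAlgebra.coeff_add, MonoidAlgebra.coeff_sub, Finsupp.add_apply,
    Finsupp.sub_apply, hc, grpElt_coeff, MonoidAlgebra.coeff_natCast, Finsupp.single_apply]
  by_cases hg : g = 1
  · subst hg
    have : ((D ×ˢ D).filter (fun x => x.1 * x.2⁻¹ = 1)).card = k := by
      rw [← hk, ← Finset.diag_card D]
      congr 1
      ext ⟨a, b⟩
      simp only [Finset.mem_filter, Finset.mem_product, Finset.mem_diag, mul_inv_eq_one]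
      constructor
      · rintro ⟨⟨a, b⟩, rfl⟩; exact ⟨a, rfl⟩
      · rintro ⟨a, rfl⟩; exact ⟨⟨a, a⟩, rfl⟩
    rw [this]
    simp [h1]
  · have : (D ×ˢ D).filter (fun x => x.1 * x.2⁻¹ = g)
        = (D ×ˢ D).filter (fun x => x.1 ≠ x.2 ∧ x.1 * x.2⁻¹ = g) := by
      apply Finset.filter_congr
      intro x _
      constructor
      · intro h
        refine ⟨?_, h⟩
        intro h'
        apply hg
        rw [← h, h', mul_inv_cancel]
      · exact fun h => h.2
    rw [this]
    by_cases hgD : g ∈ D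
    · rw [hl g hg hgD]; simp [hgD, Ne.symm hg]
    · rw [hm g hg hgD]; simp [hgD, Ne.symm hg]

lemma grpElt_pow (p : ℕ) [Fact p.Prime] (hp : (Fintype.card G).Coprime p)
    (D : Finset G) (v k l m : ℕ) (hD : IsRegularPDS D v k l m)
    (hΔ : IsSquare (((l : ℤ) - m) ^ 2 + 4 * ((k : ℤ) - m))) :
    grpElt p D ^ p = grpElt p D := by
  obtain ⟨d, hd⟩ := hΔ
  have hpar : Even ((l : ℤ) - m + d) := by
    have h : Even (((l : ℤ) - m) ^ 2 + d * d) := by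
      rw [← hd]
      exact ⟨((l : ℤ) - m) ^ 2 + 2 * ((k : ℤ) - m), by ring⟩
    rw [Int.even_add] at h ⊢
    simpa [Int.even_pow, Int.even_mul] using h
  obtain ⟨a, ha⟩ := hpar
  obtain ⟨b, hb⟩ : ∃ b : ℤ, b = (l : ℤ) - m - a := ⟨_, rfl⟩
  have hab : a * b = -((k : ℤ) - m) := by
    have hd' : d = 2 * a - (l - m) := by linarith
    subst hb
    rw [hd'] at hd
    linarith
  have hab' : (a : MonoidAlgebra (ZMod p) G) * b = -((k : MonoidAlgebra (ZMod p) G) - (m : MonoidAlgebra (ZMod p) G)) := by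
    exact_mod_cast congrArg (Int.cast : ℤ → MonoidAlgebra (ZMod p) G) hab
  have hb' : (b : MonoidAlgebra (ZMod p) G) = (l : MonoidAlgebra (ZMod p) G) - m - a := by
    exact_mod_cast congrArg (Int.cast : ℤ → MonoidAlgebra (ZMod p) G) hb
  have hsq := grpElt_sq p D v k l m hD
  have hu := grpElt_mul_univ p D
  rw [hD.1.2.1] at hu
  set x := grpElt p D
  set u : MonoidAlgebra (ZMod p) G := grpElt p univ
  have hprod : (x - (a : MonoidAlgebra (ZMod p) G)) * (x - (b : MonoidAlgebra (ZMod p) G))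
      * (x - ((k : ℤ) : MonoidAlgebra (ZMod p) G)) = 0 := by
    have h1 : (x - (a : MonoidAlgebra (ZMod p) G)) * (x - (b : MonoidAlgebra (ZMod p) G))
        = m * u := by
      linear_combination hsq + hab' - x * hb'
    rw [h1]
    push_cast
    linear_combination (m : MonoidAlgebra (ZMod p) G) * hu
  have hy : (x ^ p - x) ^ 3 = 0 := by
    have := mul_dvd_mul (mul_dvd_mul (dvd_grp p x a) (dvd_grp p x b)) (dvd_grp p x k)
    rw [hprod, zero_dvd_iff] at this
    rw [← this]; ring
  have h2 := (Fact.out : p.Prime).two_le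
  have hpp : ((x ^ p - x) ^ p) ^ p = 0 := by
    rw [← pow_mul]
    exact pow_eq_zero_of_le (by nlinarith) hy
  exact sub_eq_zero.1 (pow_eq_zero_grp p hp _ (pow_eq_zero_grp p hp _ hpp))

/-- (Local Multiplier Theorem) If `D` is a regular `(v,k,λ,μ)`-PDS in an abelian group `G`
and `Δ = (λ-μ)² + 4(k-μ)` is a perfect square, then for every `g ∈ G` and every integer `s`
coprime with the order of `g`, we have `g ∈ D ↔ g^s ∈ D`. -/
theorem stmt6 (D : Finset G) (v k l m : ℕ)
    (hD : IsRegularPDS D v k l m)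
    (hΔ : IsSquare (((l : ℤ) - m) ^ 2 + 4 * ((k : ℤ) - m))) :
    ∀ g : G, ∀ s : ℤ, Int.gcd s (orderOf g) = 1 → (g ∈ D ↔ g ^ s ∈ D) := by
  intro g s hs
  obtain ⟨p, hgt, hpp, hmod⟩ := Nat.forall_exists_prime_gt_and_zmodEq (Fintype.card G)
    (q := orderOf g) (a := s) (orderOf_pos g).ne' (Int.isCoprime_iff_gcd_eq_one.2 hs)
  have : Fact p.Prime := ⟨hpp⟩
  have hcop : (Fintype.card G).Coprime p :=
    ((Nat.Prime.coprime_iff_not_dvd hpp).2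
      (fun h => absurd (Nat.le_of_dvd Fintype.card_pos h) (by omega))).symm
  have hgs : g ^ s = g ^ p := by
    rw [← zpow_natCast, zpow_eq_zpow_iff_modEq]
    first | exact hmod | exact hmod.symm
  have h := pow_coeff p hcop (grpElt p D) g
  rw [grpElt_pow p hcop D v k l m hD hΔ, grpElt_coeff, grpElt_coeff] at h
  rw [hgs]
  by_cases h1 : g ∈ D <;> by_cases h2 : g ^ p ∈ D <;> simp_all
end
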